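/- arXiv:1612.02234 — 5 statements merged into one kernel-verified Lean document; each statement's English description precedes it below -/
import Mathlib

section
/- Up to graph isomorphism, there exist exactly 20 connected simple graphs on 6 vertices that have a unique perfect matching; that is, there is a list of 20 pairwise non-isomorphic connected simple graphs on 6 vertices, each having a unique perfect matching, such that every connected simple graph on 6 vertices with a unique perfect matching is isomorphic to one of them. -/
/-- A simple graph has a unique perfect matching (unique 1-factor) if there is
exactly one perfect matching. -/
def HasUniquePM {V : Type*} (G : SimpleGraph V) : Prop :=
  ∃! M : G.Subgraph, M.IsPerfectMatching

/-- Index of the edge `ij` in the bit mask. -/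
def eIdx (i j : Fin 6) : Nat :=
  bif Nat.ble i.val j.val then Nat.add (Nat.div (Nat.mul j.val (Nat.pred j.val)) 2) i.val
  else Nat.add (Nat.div (Nat.mul i.val (Nat.pred i.val)) 2) j.val

/-- Adjacency in the graph coded by `n`. -/
def adjB (n : Nat) (i j : Fin 6) : Bool :=
  !(Nat.beq i.val j.val) && Nat.beq (Nat.mod (Nat.shiftRight n (eIdx i j)) 2) 1

/-- The twenty graphs, as edge bit masks. -/
def repList : List Nat :=
  [16483, 16485, 16487, 16491, 16501, 16615, 16619, 16739, 16741, 16743, 16997, 16757, 16871, 17123, 16875, 17127, 17515, 17379, 17383, 17525]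

/-- The fourteen perfect matchings of `K₆` other than the standard one. -/
def otherPM : List (List (Fin 6)) :=
  [[1, 0, 4, 5, 2, 3],
   [1, 0, 5, 4, 3, 2],
   [2, 3, 0, 1, 5, 4],
   [2, 4, 0, 5, 1, 3],
   [2, 5, 0, 4, 3, 1],
   [3, 2, 1, 0, 5, 4],
   [3, 4, 5, 0, 1, 2],
   [3, 5, 4, 0, 2, 1],
   [4, 2, 1, 5, 0, 3],
   [4, 3, 5, 1, 0, 2],
   [4, 5, 3, 2, 0, 1],
   [5, 2, 1, 4, 3, 0],
   [5, 3, 4, 1, 2, 0],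
   [5, 4, 3, 2, 1, 0]]

/-- The permutations preserving the standard perfect matching. -/
def permList : List (List (Fin 6)) :=
  [[0, 1, 2, 3, 4, 5],
   [0, 1, 2, 3, 5, 4],
   [0, 1, 3, 2, 4, 5],
   [0, 1, 3, 2, 5, 4],
   [0, 1, 4, 5, 2, 3],
   [0, 1, 4, 5, 3, 2],
   [0, 1, 5, 4, 2, 3],
   [0, 1, 5, 4, 3, 2],
   [1, 0, 2, 3, 4, 5],
   [1, 0, 2, 3, 5, 4],
   [1, 0, 3, 2, 4, 5],
   [1, 0, 3, 2, 5, 4],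
   [1, 0, 4, 5, 2, 3],
   [1, 0, 4, 5, 3, 2],
   [1, 0, 5, 4, 2, 3],
   [1, 0, 5, 4, 3, 2],
   [2, 3, 0, 1, 4, 5],
   [2, 3, 0, 1, 5, 4],
   [2, 3, 1, 0, 4, 5],
   [2, 3, 1, 0, 5, 4],
   [2, 3, 4, 5, 0, 1],
   [2, 3, 4, 5, 1, 0],
   [2, 3, 5, 4, 0, 1],
   [2, 3, 5, 4, 1, 0],
   [3, 2, 0, 1, 4, 5],
   [3, 2, 0, 1, 5, 4],
   [3, 2, 1, 0, 4, 5],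
   [3, 2, 1, 0, 5, 4],
   [3, 2, 4, 5, 0, 1],
   [3, 2, 4, 5, 1, 0],
   [3, 2, 5, 4, 0, 1],
   [3, 2, 5, 4, 1, 0],
   [4, 5, 0, 1, 2, 3],
   [4, 5, 0, 1, 3, 2],
   [4, 5, 1, 0, 2, 3],
   [4, 5, 1, 0, 3, 2],
   [4, 5, 2, 3, 0, 1],
   [4, 5, 2, 3, 1, 0],
   [4, 5, 3, 2, 0, 1],
   [4, 5, 3, 2, 1, 0],
   [5, 4, 0, 1, 2, 3],
   [5, 4, 0, 1, 3, 2],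
   [5, 4, 1, 0, 2, 3],
   [5, 4, 1, 0, 3, 2],
   [5, 4, 2, 3, 0, 1],
   [5, 4, 2, 3, 1, 0],
   [5, 4, 3, 2, 0, 1],
   [5, 4, 3, 2, 1, 0]]

/-- Packed witnesses (a permutation and a representative for each labelled graph). -/
def witness : Nat :=
  4197057284949463253642380433610746154949410794693120051978414731969709892264285185884342313869796875870647065571570145047036836617937629876369119875477258615351142213768928433639122514862553539277176903808244519357014194474432029043931285865584209842804774614607999281530400592962675130751939509654467908392067401300253661426056340333345951351796038708193064753679588564797504475717271807766731445710468142601624521290799672626952444316183755047966540706828937017406146540300036468053898213207408506565116370096431445829478297094692897686585889739895791083617052719131919112179770113693246644333583988166458929229553999322338152180676720168566720021087694616854697053407354403906912996432540865950118988530375554948287476444373493845080197411299649848058868384304783384921855580063769115640421155351657840066512172032224369820995774971914449264141439473311097892512207964098343659062221179184831260678957797129813530325364027194163589095069720788251565639178294665226852230917040768091457263862771362890067925596328502217017807388319800415876233926632851436188409511870526701279539891333130996047789005734571225623003165295967073999056420812547022956521424623705285920005152800166003943591844450896708459734471290285944947370981012756592112652570744390745754500382327180621060184505381509254261114250607941652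5189741966986435494193556760451462658271122628488565731923849819731804551108586302004498737752364641289553239236482848683730180949710144070553583379959803038102269940594860432655205665333470330981586427411262364639769865597318331675949890994767136564160

theorem eIdx_symm : ∀ i j : Fin 6, eIdx i j = eIdx j i := by decide

theorem adjB_iff (n : Nat) (i j : Fin 6) :
    adjB n i j = true ↔ i ≠ j ∧ n.testBit (eIdx i j) = true := by
  have h : (n.testBit (eIdx i j) = true) ↔ (n >>> (eIdx i j)) % 2 = 1 := by
    rw [Nat.testBit_eq_decide_div_mod_eq, Nat.shiftRight_eq_div_pow]; simp
  rw [h]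
  unfold adjB
  rw [Bool.and_eq_true, Nat.beq_eq, Bool.not_eq_true', ← Bool.not_eq_true, Nat.beq_eq]
  rw [ne_eq, Fin.ext_iff]
  exact Iff.rfl

theorem adjB_symm (n : Nat) (i j : Fin 6) : adjB n i j = true → adjB n j i = true := by
  rw [adjB_iff, adjB_iff, eIdx_symm i j]
  exact fun h => ⟨h.1.symm, h.2⟩

/-- The graph coded by `n`. -/
def mkG (n : Nat) : SimpleGraph (Fin 6) where
  Adj i j := adjB n i j = true
  symm := ⟨fun i j h => adjB_symm n i j h⟩
  loopless := ⟨fun i h => ((adjB_iff n i i).1 h).1 rfl⟩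

/-- Bounded quantifier over `Fin 6`. -/
def all6 (f : Fin 6 → Bool) : Bool := f 0 && (f 1 && (f 2 && (f 3 && (f 4 && f 5))))

theorem all6_iff (f : Fin 6 → Bool) : all6 f = true ↔ ∀ i, f i = true := by
  simp [all6, Fin.forall_fin_succ]

/-- A backtracking search over functions `Fin 6 → Fin 6` satisfying pairwise constraints. -/
def search6 (c : Fin 6 → Fin 6 → Fin 6 → Fin 6 → Bool)
    (leaf : Fin 6 → Fin 6 → Fin 6 → Fin 6 → Fin 6 → Fin 6 → Bool) : Bool :=
  all6 fun a => all6 fun b => !(c 0 1 a b) ||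
  all6 fun x => !(c 0 2 a x && c 1 2 b x) ||
  all6 fun y => !(c 0 3 a y && (c 1 3 b y && c 2 3 x y)) ||
  all6 fun z => !(c 0 4 a z && (c 1 4 b z && (c 2 4 x z && c 3 4 y z))) ||
  all6 fun w => !(c 0 5 a w && (c 1 5 b w && (c 2 5 x w && (c 3 5 y w && c 4 5 z w)))) ||
  leaf a b x y z w

theorem search6_sound {c leaf} (h : search6 c leaf = true) (f : Fin 6 → Fin 6)
    (hf : ∀ i j, i ≠ j → c i j (f i) (f j) = true) :
    leaf (f 0) (f 1) (f 2) (f 3) (f 4) (f 5) = true := by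
  unfold search6 at h
  have h1 := (all6_iff _).1 ((all6_iff _).1 h (f 0)) (f 1)
  rw [hf 0 1 (by decide), Bool.not_true, Bool.false_or] at h1
  have h2 := (all6_iff _).1 h1 (f 2)
  rw [hf 0 2 (by decide), hf 1 2 (by decide)] at h2
  simp only [Bool.and_true, Bool.not_true, Bool.false_or] at h2
  have h3 := (all6_iff _).1 h2 (f 3)
  rw [hf 0 3 (by decide), hf 1 3 (by decide), hf 2 3 (by decide)] at h3
  simp only [Bool.and_true, Bool.not_true, Bool.false_or] at h3
  have h4 := (all6_iff _).1 h3 (f 4)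
  rw [hf 0 4 (by decide), hf 1 4 (by decide), hf 2 4 (by decide), hf 3 4 (by decide)] at h4
  simp only [Bool.and_true, Bool.not_true, Bool.false_or] at h4
  have h5 := (all6_iff _).1 h4 (f 5)
  rw [hf 0 5 (by decide), hf 1 5 (by decide), hf 2 5 (by decide), hf 3 5 (by decide),
    hf 4 5 (by decide)] at h5
  simpa only [Bool.and_true, Bool.not_true, Bool.false_or] using h5

/-! ### Non-isomorphism -/

/-- Equality of Booleans. -/
def beqB (a b : Bool) : Bool := bif a then b else !b

theorem beqB_iff (a b : Bool) : beqB a b = true ↔ a = b := by cases a <;> cases b <;> decide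

def noIso (m n : Nat) : Bool :=
  search6 (fun i j a b => !(Nat.beq a.val b.val) && beqB (adjB m i j) (adjB n a b))
    (fun _ _ _ _ _ _ => false)

theorem noIso_sound {m n : Nat} (h : noIso m n = true) : ¬ Nonempty (mkG m ≃g mkG n) := by
  rintro ⟨e⟩
  have := search6_sound h e (fun i j hij => by
    rw [Bool.and_eq_true, Bool.not_eq_true', ← Bool.not_eq_true, Nat.beq_eq, beqB_iff]
    refine ⟨fun hh => hij (e.injective (Fin.ext hh)), ?_⟩
    have := e.map_rel_iff (a := i) (b := j)
    exact (Bool.eq_iff_iff.2 this).symm)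
  cases this

theorem reps_noIso : repList.Pairwise (fun m n => noIso m n = true) := by decide +kernel

/-! ### Perfect matchings as involutions -/

/-- `p` is the partner function of a perfect matching of `G`. -/
def GoodInv (G : SimpleGraph (Fin 6)) (p : Fin 6 → Fin 6) : Prop :=
  ∀ v, p (p v) = v ∧ G.Adj v (p v)

/-- The subgraph of a partner function. -/
def invSub (G : SimpleGraph (Fin 6)) (p : Fin 6 → Fin 6) (hp : GoodInv G p) : G.Subgraph where
  verts := Set.univ
  Adj a b := p a = b
  adj_sub := by rintro a b rfl; exact (hp a).2
  edge_vert := fun _ => Set.mem_univ _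
  symm := ⟨by rintro a b rfl; exact (hp a).1⟩

theorem invSub_pm (G : SimpleGraph (Fin 6)) (p : Fin 6 → Fin 6) (hp : GoodInv G p) :
    (invSub G p hp).IsPerfectMatching := by
  rw [SimpleGraph.Subgraph.isPerfectMatching_iff]
  exact fun v => ⟨p v, rfl, fun y hy => Eq.symm hy⟩

theorem exists_goodInv {G : SimpleGraph (Fin 6)} {M : G.Subgraph} (hM : M.IsPerfectMatching) :
    ∃ p, GoodInv G p ∧ ∀ a b, M.Adj a b ↔ p a = b := by
  rw [SimpleGraph.Subgraph.isPerfectMatching_iff] at hM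
  choose p hp hq using hM
  refine ⟨p, fun v => ⟨(hq _ _ (hp v).symm).symm, (hp v).adj_sub⟩, fun a b => ⟨fun h => (hq _ _ h).symm, ?_⟩⟩
  rintro rfl
  exact hp a

theorem uniquePM_of {G : SimpleGraph (Fin 6)} {p : Fin 6 → Fin 6} (hp : GoodInv G p)
    (hu : ∀ q, GoodInv G q → q = p) : HasUniquePM G := by
  refine ⟨invSub G p hp, invSub_pm G p hp, fun M hM => ?_⟩
  obtain ⟨q, hq, hMq⟩ := exists_goodInv hM
  have := hu q hq
  subst this
  refine SimpleGraph.Subgraph.ext ?_ ?_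
  · exact SimpleGraph.Subgraph.isSpanning_iff.1 hM.2
  · funext a b
    exact propext (hMq a b)

theorem of_uniquePM {G : SimpleGraph (Fin 6)} (h : HasUniquePM G) :
    ∃ p, GoodInv G p ∧ ∀ q, GoodInv G q → q = p := by
  obtain ⟨M, hM, hu⟩ := h
  obtain ⟨p, hp, hMp⟩ := exists_goodInv hM
  refine ⟨p, hp, fun q hq => ?_⟩
  have := hu _ (invSub_pm G q hq)
  funext v
  have h2 : (invSub G q hq).Adj v (q v) := rfl
  rw [this] at h2
  exact ((hMp _ _).1 h2).symm

/-- A function given by its list of values. -/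
def lf (l : List (Fin 6)) (v : Fin 6) : Fin 6 := l.getD v.val 0

/-- The standard matching. -/
def stdP : List (Fin 6) := [1, 0, 3, 2, 5, 4]

def uniqB (n : Nat) : Bool :=
  search6 (fun i j a b => adjB n i a && (adjB n j b &&
      beqB (Nat.beq a.val j.val) (Nat.beq b.val i.val)))
    (fun a b x y z w => Nat.beq a.val 1 && (Nat.beq b.val 0 && (Nat.beq x.val 3 &&
      (Nat.beq y.val 2 && (Nat.beq z.val 5 && Nat.beq w.val 4)))))

/-- Everything needed about a representative. -/
def repOK (n : Nat) : Bool :=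
  uniqB n && (all6 fun v => adjB n v (lf stdP v)) &&
  (adjB n 0 1 && (adjB n 0 2 || adjB n 1 2) && adjB n 2 3 &&
    (adjB n 0 4 || adjB n 1 4 || adjB n 2 4 || adjB n 3 4) && adjB n 4 5)

theorem reps_ok : ∀ n ∈ repList, repOK n = true := by decide +kernel

theorem repOK_sound {n : Nat} (h : repOK n = true) : (mkG n).Connected ∧ HasUniquePM (mkG n) := by
  simp only [repOK, Bool.and_eq_true, Bool.or_eq_true] at h
  obtain ⟨⟨hu, hs⟩, ⟨⟨⟨h01, h2⟩, h23⟩, h4⟩, h45⟩ := h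
  constructor
  · have adj : ∀ i j, adjB n i j = true → (mkG n).Reachable 0 i → (mkG n).Reachable 0 j :=
      fun i j hij hi => hi.trans (SimpleGraph.Adj.reachable (G := mkG n) hij)
    have r0 : (mkG n).Reachable 0 0 := SimpleGraph.Reachable.refl _
    have r1 := adj _ _ h01 r0
    have r2 : (mkG n).Reachable 0 2 := h2.elim (fun h => adj _ _ h r0) (fun h => adj _ _ h r1)
    have r3 := adj _ _ h23 r2
    have r4 : (mkG n).Reachable 0 4 := by
      rcases h4 with ((h | h) | h) | h
      · exact adj _ _ h r0
      · exact adj _ _ h r1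
      · exact adj _ _ h r2
      · exact adj _ _ h r3
    have r5 := adj _ _ h45 r4
    have r : ∀ i, (mkG n).Reachable 0 i := by
      intro i
      fin_cases i
      exacts [r0, r1, r2, r3, r4, r5]
    exact ⟨fun i j => (r i).symm.trans (r j)⟩
  · have inv : ∀ v, lf stdP (lf stdP v) = v := by decide
    refine uniquePM_of (p := lf stdP) (fun v => ⟨inv v, (all6_iff _).1 hs v⟩) (fun q hq => ?_)
    have := search6_sound hu q (fun i j hij => by
      rw [Bool.and_eq_true, Bool.and_eq_true, beqB_iff]
      refine ⟨(hq i).2, (hq j).2, ?_⟩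
      rw [Bool.eq_iff_iff, Nat.beq_eq, Nat.beq_eq]
      refine ⟨fun h => ?_, fun h => ?_⟩
      · rw [← Fin.ext h, (hq i).1]
      · rw [← Fin.ext h, (hq j).1])
    simp only [Bool.and_eq_true, Nat.beq_eq] at this
    obtain ⟨h0, h1, h2, h3, h4, h5⟩ := this
    funext v
    fin_cases v
    exacts [Fin.ext h0, Fin.ext h1, Fin.ext h2, Fin.ext h3, Fin.ext h4, Fin.ext h5]

/-! ### Completeness -/

/-- The cut between `{a, b}` and the rest is empty. -/
def cutB (n : Nat) (a b : Fin 6) : Bool :=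
  all6 fun v => Nat.beq v.val a.val || (Nat.beq v.val b.val || (!(adjB n a v) && !(adjB n b v)))

def badPM (n : Nat) : Bool := otherPM.any fun l => all6 fun v => adjB n v (lf l v)

def easyB (n : Nat) : Bool :=
  !(adjB n 0 1) || (!(adjB n 2 3) || (!(adjB n 4 5) ||
    (badPM n || (cutB n 0 1 || (cutB n 2 3 || cutB n 4 5)))))

def isoW (n w : Nat) : Bool :=
  let s := permList.getD (Nat.div w 20) stdP
  let m := repList.getD (Nat.mod w 20) 16483
  all6 fun i => all6 fun j => beqB (adjB n i j) (adjB m (lf s i) (lf s j))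

/-- Traverse all masks, consuming the witnesses. -/
def go : Nat → Nat → Nat → Option Nat
  | 0, a, W => bif easyB a then some W else
      bif isoW a (Nat.mod W 960) then some (Nat.div W 960) else none
  | k + 1, a, W => match go k (Nat.mul 2 a) W with
    | none => none
    | some W' => go k (Nat.add (Nat.mul 2 a) 1) W'

theorem go_sound (k : Nat) : ∀ a W, (go k a W).isSome = true →
    ∀ n < 2 ^ k, easyB (a * 2 ^ k + n) = true ∨ ∃ w, isoW (a * 2 ^ k + n) w = true := by
  induction k with
  | zero =>
    intro a W h n hn
    have : n = 0 := by simpa using hn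
    subst this
    simp only [pow_zero, mul_one, add_zero]
    cases he : easyB a with
    | true => exact Or.inl rfl
    | false =>
      right
      refine ⟨Nat.mod W 960, ?_⟩
      cases hi : isoW a (Nat.mod W 960) with
      | true => rfl
      | false => simp [go, he, hi] at h
  | succ k ih =>
    intro a W h n hn
    rw [go] at h
    cases hg : go k (Nat.mul 2 a) W with
    | none => rw [hg] at h; cases h
    | some W' =>
      rw [hg] at h
      by_cases hlt : n < 2 ^ k
      · have := ih (Nat.mul 2 a) W (by rw [hg]; rfl) n hlt
        have e : Nat.mul 2 a * 2 ^ k = a * 2 ^ (k + 1) := by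
          change 2 * a * 2 ^ k = _
          ring
        rwa [e] at this
      · have := ih _ W' h (n - 2 ^ k) (by rw [pow_succ] at hn; omega)
        have e : (Nat.add (Nat.mul 2 a) 1) * 2 ^ k + (n - 2 ^ k) = a * 2 ^ (k + 1) + n := by
          change (2 * a + 1) * 2 ^ k + (n - 2 ^ k) = _
          have : (2 * a + 1) * 2 ^ k = a * 2 ^ (k + 1) + 2 ^ k := by ring
          omega
        rwa [e] at this

theorem go_all : (go 15 0 witness).isSome = true := by decide +kernel

theorem perms_inj : ∀ l ∈ permList, Function.Injective (lf l) := by decide +kernel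

theorem stdP_inj : Function.Injective (lf stdP) := by decide +kernel

theorem getD_prop {α : Type*} {P : α → Prop} (l : List α) (h : ∀ x ∈ l, P x) (d : α) (hd : P d)
    (k : Nat) : P (l.getD k d) := by
  rw [List.getD_eq_getElem?_getD]
  cases hk : l[k]? with
  | none => exact hd
  | some x => exact h x (List.mem_of_getElem? hk)

theorem isoW_sound {n w : Nat} (h : isoW n w = true) :
    ∃ m ∈ repList, Nonempty (mkG n ≃g mkG m) := by
  refine ⟨repList.getD (Nat.mod w 20) 16483,
    getD_prop (P := fun m => m ∈ repList) repList (fun _ hx => hx) _ (by decide) _, ?_⟩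
  have hinj : Function.Injective (lf (permList.getD (Nat.div w 20) stdP)) :=
    getD_prop (P := fun l => Function.Injective (lf l)) permList perms_inj _ stdP_inj _
  refine ⟨⟨Equiv.ofBijective _ (Finite.injective_iff_bijective.1 hinj), fun {i j} => ?_⟩⟩
  unfold isoW at h
  have h1 := (all6_iff _).1 ((all6_iff _).1 h i) j
  have := (beqB_iff _ _).1 h1
  exact (Bool.eq_iff_iff.1 this).symm

/-- Endpoints of the edge of given index. -/
def ends (k : Fin 15) : Fin 6 × Fin 6 :=
  [(0, 1), (0, 2), (1, 2), (0, 3), (1, 3), (2, 3), (0, 4), (1, 4), (2, 4), (3, 4),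
    (0, 5), (1, 5), (2, 5), (3, 5), (4, 5)].getD k.val (0, 0)

theorem ends_eIdx : ∀ i j : Fin 6, i ≠ j → ∃ h : eIdx i j < 15,
    ends ⟨eIdx i j, h⟩ = (i, j) ∨ ends ⟨eIdx i j, h⟩ = (j, i) := by decide

theorem exists_code (G : SimpleGraph (Fin 6)) : ∃ n < 2 ^ 15, mkG n = G := by
  classical
  refine ⟨Nat.ofBits (fun k : Fin 15 => decide (G.Adj (ends k).1 (ends k).2)),
    Nat.ofBits_lt_two_pow _, ?_⟩
  ext i j
  change adjB _ i j = true ↔ _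
  rw [adjB_iff]
  by_cases hij : i = j
  · subst hij; simp
  · obtain ⟨h, he⟩ := ends_eIdx i j hij
    rw [Nat.testBit_ofBits_lt _ _ h]
    rcases he with he | he
    · rw [he]; simp [hij]
    · rw [he]; simp [hij, G.adj_comm j i]

theorem cut_sound {n : Nat} {a b : Fin 6} (h : cutB n a b = true) (hc : (mkG n).Connected)
    (x : Fin 6) (hxa : x ≠ a) (hxb : x ≠ b) : False := by
  have key : ∀ u v, (mkG n).Adj u v → (u = a ∨ u = b) → (v = a ∨ v = b) := by
    intro u v huv hu
    by_contra hv
    push Not at hv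
    have h1 := (all6_iff _).1 h v
    simp only [Bool.or_eq_true, Bool.and_eq_true, Nat.beq_eq, Bool.not_eq_true'] at h1
    rcases h1 with h1 | h1 | ⟨h1, h2⟩
    · exact hv.1 (Fin.ext h1)
    · exact hv.2 (Fin.ext h1)
    · rcases hu with rfl | rfl
      · exact absurd (show adjB n u v = true from huv) (by simp [h1])
      · exact absurd (show adjB n u v = true from huv) (by simp [h2])
  obtain ⟨p⟩ := hc.preconnected a x
  have : ∀ u v, (mkG n).Walk u v → (u = a ∨ u = b) → (v = a ∨ v = b) := by
    intro u v p
    induction p with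
    | nil => exact id
    | cons h _ ih => exact fun hu => ih (key _ _ h hu)
  exact (this _ _ p (Or.inl rfl)).elim hxa hxb

theorem other_inv : ∀ l ∈ otherPM, (∀ v, lf l (lf l v) = v) ∧ lf l ≠ lf stdP := by decide +kernel

theorem complete_std {G : SimpleGraph (Fin 6)} (hc : G.Connected) (hp : GoodInv G (lf stdP))
    (hu : ∀ q, GoodInv G q → q = lf stdP) : ∃ m ∈ repList, Nonempty (G ≃g mkG m) := by
  obtain ⟨n, hn, rfl⟩ := exists_code G
  have := go_sound 15 0 witness go_all n hn
  rw [zero_mul, zero_add] at this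
  rcases this with h | ⟨w, h⟩
  · exfalso
    have e0 : adjB n 0 1 = true := (hp 0).2
    have e2 : adjB n 2 3 = true := (hp 2).2
    have e4 : adjB n 4 5 = true := (hp 4).2
    rw [easyB, e0, e2, e4] at h
    simp only [Bool.not_true, Bool.false_or, Bool.or_eq_true] at h
    rcases h with h | h | h | h
    · obtain ⟨l, hl, h⟩ := List.any_eq_true.1 h
      have ⟨h1, h2⟩ := other_inv l hl
      exact h2 (hu _ fun v => ⟨h1 v, (all6_iff _).1 h v⟩)
    · exact cut_sound h hc 2 (by decide) (by decide)
    · exact cut_sound h hc 0 (by decide) (by decide)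
    · exact cut_sound h hc 0 (by decide) (by decide)
  · exact isoW_sound h

theorem exists_relabel (p : Fin 6 → Fin 6) (hp : ∀ v, p (p v) = v) (hf : ∀ v, p v ≠ v) :
    ∃ s : Fin 6 ≃ Fin 6, ∀ v, p (s v) = s (lf stdP v) := by
  have ex1 : ∀ a : Fin 6, ∃ c : Fin 6, c ≠ 0 ∧ c ≠ a := by decide
  have ex2 : ∀ a c d : Fin 6, ∃ e : Fin 6, e ≠ 0 ∧ e ≠ a ∧ e ≠ c ∧ e ≠ d := by decide
  obtain ⟨c, hc0, hca⟩ := ex1 (p 0)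
  obtain ⟨e, he0, hea, hec, hed⟩ := ex2 (p 0) c (p c)
  have sw : ∀ {x y}, p x = y → x = p y := fun {x y} h => by rw [← h, hp]
  have pi : ∀ {x y}, p x = p y → x = y := fun {x y} h => by rw [sw h, hp]
  have hinj : Function.Injective (lf [0, p 0, c, p c, e, p e]) := by
    have f0 := hf 0
    have fc := hf c
    have fe := hf e
    have a1 : p c ≠ 0 := fun h => hca (sw h)
    have a2 : p c ≠ p 0 := fun h => hc0 (pi h)
    have a3 : p e ≠ 0 := fun h => hea (sw h)
    have a4 : p e ≠ p 0 := fun h => he0 (pi h)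
    have a5 : p e ≠ c := fun h => hed (sw h)
    have a6 : p e ≠ p c := fun h => hec (pi h)
    intro i j hij
    fin_cases i <;> fin_cases j <;> first
      | rfl
      | (exfalso; simp [lf] at hij; first | exact absurd hij (by assumption) | exact absurd hij.symm (by assumption))
  refine ⟨Equiv.ofBijective _ (Finite.injective_iff_bijective.1 hinj), fun v => ?_⟩
  fin_cases v
  exacts [rfl, hp 0, rfl, hp c, rfl, hp e]

theorem complete (G : SimpleGraph (Fin 6)) (hc : G.Connected) (h : HasUniquePM G) :
    ∃ m ∈ repList, Nonempty (G ≃g mkG m) := by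
  obtain ⟨p, hp, hu⟩ := of_uniquePM h
  obtain ⟨s, hs⟩ := exists_relabel p (fun v => (hp v).1) (fun v h => (hp v).2.ne h.symm)
  have iso : G.comap s ≃g G := SimpleGraph.Iso.comap s G
  have inv : ∀ v, lf stdP (lf stdP v) = v := by decide
  obtain ⟨m, hm, ⟨e⟩⟩ := complete_std (G := G.comap s) (iso.connected_iff.2 hc)
    (fun v => ⟨inv v, by
      change G.Adj (s v) (s (lf stdP v))
      rw [← hs]; exact (hp _).2⟩)
    (fun q hq => by
      have := hu (fun v => s (q (s.symm v))) (fun v => ⟨by simp [(hq _).1], by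
        have := (hq (s.symm v)).2
        change G.Adj (s (s.symm v)) _ at this
        rwa [s.apply_symm_apply] at this⟩)
      funext v
      have h2 := congrFun this (s v)
      simp only [Equiv.symm_apply_apply] at h2
      exact s.injective (h2.trans (hs v)))
  exact ⟨m, hm, ⟨iso.symm.trans e⟩⟩

/-- up to isomorphism, there are exactly 20 connected simple graphs
on 6 vertices with a unique perfect matching. -/
theorem stmt7 : ∃ L : List (SimpleGraph (Fin 6)),
    L.length = 20 ∧
    L.Pairwise (fun G H => ¬ Nonempty (G ≃g H)) ∧
    (∀ G ∈ L, G.Connected ∧ HasUniquePM G) ∧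
    (∀ G : SimpleGraph (Fin 6), G.Connected → HasUniquePM G →
      ∃ H ∈ L, Nonempty (G ≃g H)) := by
  refine ⟨repList.map mkG, by simp [repList], ?_, ?_, ?_⟩
  · rw [List.pairwise_map]
    exact reps_noIso.imp (fun h => noIso_sound h)
  · intro G hG
    obtain ⟨n, hn, rfl⟩ := List.mem_map.1 hG
    exact repOK_sound (reps_ok n hn)
  · intro G hc hu
    obtain ⟨m, hm, he⟩ := complete G hc hu
    exact ⟨mkG m, List.mem_map_of_mem hm, he⟩
end

section
/- Up to graph isomorphism, exactly 3 of the connected simple graphs on 6 vertices with a unique perfect matching are bipartite. -/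
/-- Involutions choosing a neighbour of each vertex. -/
def IsMatchFun {V : Type*} (G : SimpleGraph V) (f : V → V) : Prop :=
  ∀ v, f (f v) = v ∧ G.Adj v (f v)

/-- The perfect matching of an involution. -/
def matchSub {V : Type*} (G : SimpleGraph V) (f : V → V) (hf : IsMatchFun G f) : G.Subgraph where
  verts := Set.univ
  Adj x y := f x = y
  adj_sub := by
    intro x y h
    subst h
    exact (hf x).2
  edge_vert := fun _ => trivial
  symm := ⟨fun x y h => by
    subst h
    exact (hf x).1⟩

theorem matchSub_pm {V : Type*} (G : SimpleGraph V) (f : V → V) (hf : IsMatchFun G f) :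
    (matchSub G f hf).IsPerfectMatching := by
  rw [SimpleGraph.Subgraph.isPerfectMatching_iff]
  intro v
  exact ⟨f v, rfl, fun y h => Eq.symm h⟩

theorem exists_matchFun {V : Type*} {G : SimpleGraph V} {M : G.Subgraph}
    (hM : M.IsPerfectMatching) : ∃ f, IsMatchFun G f ∧ ∀ x y, M.Adj x y ↔ f x = y := by
  rw [SimpleGraph.Subgraph.isPerfectMatching_iff] at hM
  choose f hf hu using hM
  have key : ∀ x y, M.Adj x y ↔ f x = y :=
    fun x y => ⟨fun h => (hu x y h).symm, fun h => h ▸ hf x⟩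
  exact ⟨f, fun v => ⟨(key _ _).1 (hf v).symm, (hf v).adj_sub⟩, key⟩

theorem hasUniquePM_iff {V : Type*} (G : SimpleGraph V) :
    HasUniquePM G ↔ ∃! f, IsMatchFun G f := by
  constructor
  · rintro ⟨M, hM, hu⟩
    obtain ⟨f, hf, hk⟩ := exists_matchFun hM
    refine ⟨f, hf, fun g hg => ?_⟩
    have := hu _ (matchSub_pm G g hg)
    funext x
    have h2 : (matchSub G g hg).Adj x (g x) := rfl
    rw [this] at h2
    exact ((hk _ _).1 h2).symm
  · rintro ⟨f, hf, hu⟩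
    refine ⟨_, matchSub_pm G f hf, fun N hN => ?_⟩
    obtain ⟨g, hg, hk⟩ := exists_matchFun hN
    have := hu g hg
    subst this
    ext x y
    · simp [matchSub, hN.2 x]
    · rw [hk]; rfl

/-- The bipartite graph of a relation. -/
def bip (R : Fin 3 → Fin 3 → Bool) : SimpleGraph (Fin 3 ⊕ Fin 3) where
  Adj x y := match x, y with
    | .inl i, .inr j => R i j = true
    | .inr j, .inl i => R i j = true
    | _, _ => False
  symm := ⟨by rintro (i | i) (j | j) h <;> exact h⟩
  loopless := ⟨by rintro (i | i) h <;> exact h⟩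

instance bipDec (R : Fin 3 → Fin 3 → Bool) : DecidableRel (bip R).Adj := fun x y => by
  rcases x with i | i <;> rcases y with j | j <;> simp only [bip] <;> infer_instance

/-- Upper triangular relations with unit diagonal. -/
def tri (p q r : Bool) : Fin 3 → Fin 3 → Bool :=
  ![![true, p, r], ![false, true, q], ![false, false, true]]

/-- The same graph on six vertices. -/
def bip6 (p q r : Bool) : SimpleGraph (Fin 6) :=
  SimpleGraph.fromRel fun x y =>
    (x = 0 ∧ y = 3) ∨ (x = 1 ∧ y = 4) ∨ (x = 2 ∧ y = 5) ∨
    (x = 0 ∧ y = 4 ∧ p = true) ∨ (x = 1 ∧ y = 5 ∧ q = true) ∨ (x = 0 ∧ y = 5 ∧ r = true)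

instance bip6Dec (p q r : Bool) : DecidableRel (bip6 p q r).Adj := fun x y => by
  simp only [bip6, SimpleGraph.fromRel_adj]; infer_instance

theorem bip_iso (p q r : Bool) : Nonempty (bip (tri p q r) ≃g bip6 p q r) := by
  refine ⟨⟨(finSumFinEquiv : Fin 3 ⊕ Fin 3 ≃ Fin 6), ?_⟩⟩
  revert p q r
  decide

theorem bip_swap : Nonempty (bip (tri false true true) ≃g bip (tri true false true)) := by
  refine ⟨⟨(Equiv.sumComm _ _).trans (Equiv.sumCongr Fin.revPerm Fin.revPerm), ?_⟩⟩
  decide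

theorem bip6_unique (p q r : Bool) : HasUniquePM (bip6 p q r) := by
  rw [hasUniquePM_iff]
  refine ⟨![3, 4, 5, 0, 1, 2], ?_, ?_⟩
  · unfold IsMatchFun
    revert p q r
    decide
  · intro g hg
    have h0 := (hg 0).2
    have h1 := (hg 1).2
    have h2 := (hg 2).2
    have h3 := (hg 3).2
    have h4 := (hg 4).2
    have h5 := (hg 5).2
    have g2 := (hg 2).1
    have g3 := (hg 3).1
    have g5 := (hg 5).1
    have g4 := (hg 4).1
    have e3 : g 3 = 0 := by
      exact (by decide : ∀ (p q r : Bool) (a : Fin 6), (bip6 p q r).Adj 3 a → a = 0) p q r _ h3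
    have e2 : g 2 = 5 := by
      exact (by decide : ∀ (p q r : Bool) (a : Fin 6), (bip6 p q r).Adj 2 a → a = 5) p q r _ h2
    rw [e3] at g3
    rw [e2] at g2
    have e4 : g 4 = 1 := by
      have : g 4 ≠ 0 := by
        intro h
        rw [h, g3] at g4
        exact absurd g4 (by decide)
      exact (by decide : ∀ (p q r : Bool) (a : Fin 6), (bip6 p q r).Adj 4 a → a ≠ 0 → a = 1) p q r _ h4 this
    rw [e4] at g4
    funext x
    fin_cases x <;> simp [*]

theorem bip6_color (p q r : Bool) : (bip6 p q r).Colorable 2 := by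
  refine ⟨SimpleGraph.Coloring.mk (fun x => if x < 3 then 0 else 1) ?_⟩
  intro v w
  revert p q r v w
  decide

theorem bip6_conn (p q r : Bool) (hpr : p = true) (h : q = true ∨ r = true) :
    (bip6 p q r).Connected := by
  rw [SimpleGraph.connected_iff_exists_forall_reachable]
  subst hpr
  refine ⟨0, ?_⟩
  have h3 : (bip6 true q r).Reachable 0 3 :=
    SimpleGraph.Adj.reachable (by revert q r; decide)
  have h4 : (bip6 true q r).Reachable 0 4 :=
    SimpleGraph.Adj.reachable (by revert q r; decide)
  have h1 : (bip6 true q r).Reachable 0 1 :=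
    h4.trans (SimpleGraph.Adj.reachable (by revert q r; decide))
  have h5 : (bip6 true q r).Reachable 0 5 := by
    rcases h with h | h
    · exact h1.trans (SimpleGraph.Adj.reachable (by revert q r; decide))
    · exact (SimpleGraph.Adj.reachable (by revert q r; decide))
  have h2 : (bip6 true q r).Reachable 0 2 :=
    h5.trans (SimpleGraph.Adj.reachable (by revert q r; decide))
  intro v
  fin_cases v
  · exact SimpleGraph.Reachable.refl _
  all_goals assumption

theorem tri_exists : ∀ R : Fin 3 → Fin 3 → Bool, (∀ i, R i i = true) →
    (∀ σ : Equiv.Perm (Fin 3), (∀ i, R i (σ i) = true) → σ = 1) →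
    ∃ (τ : Equiv.Perm (Fin 3)) (p q r : Bool), ∀ i j, R (τ i) (τ j) = tri p q r i j := by
  intro R hd hu
  have h : ∃ τ : Equiv.Perm (Fin 3), R (τ 1) (τ 0) = false ∧ R (τ 2) (τ 0) = false ∧
      R (τ 2) (τ 1) = false := by
    have d0 := hd 0
    have d1 := hd 1
    have d2 := hd 2
    have key : ∀ σ : Equiv.Perm (Fin 3), σ ≠ 1 → ¬ (R 0 (σ 0) = true ∧ R 1 (σ 1) = true ∧
        R 2 (σ 2) = true) := by
      intro σ hs h
      exact hs (hu σ (fun i => by fin_cases i <;> simp [h]))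
    have k1 := key (Equiv.swap 0 1) (by decide)
    have k2 := key (Equiv.swap 0 2) (by decide)
    have k3 := key (Equiv.swap 1 2) (by decide)
    have k4 := key (finRotate 3) (by decide)
    have k5 := key (finRotate 3)⁻¹ (by decide)
    rw [show Equiv.swap (0 : Fin 3) 1 0 = 1 by decide, show Equiv.swap (0 : Fin 3) 1 1 = 0 by decide,
      show Equiv.swap (0 : Fin 3) 1 2 = 2 by decide] at k1
    rw [show Equiv.swap (0 : Fin 3) 2 0 = 2 by decide, show Equiv.swap (0 : Fin 3) 2 1 = 1 by decide,
      show Equiv.swap (0 : Fin 3) 2 2 = 0 by decide] at k2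
    rw [show Equiv.swap (1 : Fin 3) 2 0 = 0 by decide, show Equiv.swap (1 : Fin 3) 2 1 = 2 by decide,
      show Equiv.swap (1 : Fin 3) 2 2 = 1 by decide] at k3
    rw [show finRotate 3 0 = 1 by decide, show finRotate 3 1 = 2 by decide,
      show finRotate 3 2 = 0 by decide] at k4
    rw [show (finRotate 3)⁻¹ 0 = 2 by decide, show (finRotate 3)⁻¹ 1 = 0 by decide,
      show (finRotate 3)⁻¹ 2 = 1 by decide] at k5
    have build : ∀ a b c : Fin 3, a ≠ b → a ≠ c → b ≠ c → R b a = false → R c a = false →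
        R c b = false → ∃ τ : Equiv.Perm (Fin 3), R (τ 1) (τ 0) = false ∧ R (τ 2) (τ 0) = false ∧
      R (τ 2) (τ 1) = false := by
      intro a b c hab hac hbc x y z
      have : ∃ τ : Equiv.Perm (Fin 3), τ 0 = a ∧ τ 1 = b ∧ τ 2 = c := by
        clear x y z
        revert a b c
        decide
      obtain ⟨τ, rfl, rfl, rfl⟩ := this
      exact ⟨τ, x, y, z⟩
    by_contra hn
    have b1 := fun x y z => hn (build 0 1 2 (by decide) (by decide) (by decide) x y z)
    have b2 := fun x y z => hn (build 0 2 1 (by decide) (by decide) (by decide) x y z)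
    have b3 := fun x y z => hn (build 1 0 2 (by decide) (by decide) (by decide) x y z)
    have b4 := fun x y z => hn (build 1 2 0 (by decide) (by decide) (by decide) x y z)
    have b5 := fun x y z => hn (build 2 0 1 (by decide) (by decide) (by decide) x y z)
    have b6 := fun x y z => hn (build 2 1 0 (by decide) (by decide) (by decide) x y z)
    clear build key hn hu hd
    rw [d0] at *
    rw [d1] at *
    rw [d2] at *
    revert k1 k2 k3 k4 k5 b1 b2 b3 b4 b5 b6
    clear d0 d1 d2
    generalize R 0 1 = a
    generalize R 0 2 = b
    generalize R 1 0 = c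
    generalize R 1 2 = d
    generalize R 2 0 = e
    generalize R 2 1 = f
    rcases a <;> rcases b <;> rcases c <;> rcases d <;> rcases e <;> rcases f <;> simp
  obtain ⟨τ, h1, h2, h3⟩ := h
  refine ⟨τ, R (τ 0) (τ 1), R (τ 1) (τ 2), R (τ 0) (τ 2), ?_⟩
  intro i j
  fin_cases i <;> fin_cases j <;> simp [tri, hd, h1, h2, h3]

theorem conn_cut {R : Fin 3 → Fin 3 → Bool} (h : (bip R).Connected) (i : Fin 3) :
    ∃ j, j ≠ i ∧ (R i j = true ∨ R j i = true) := by
  obtain ⟨k, hk⟩ : ∃ k : Fin 3, k ≠ i := by revert i; decide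
  obtain ⟨w⟩ := h.preconnected (.inl i) (.inl k)
  obtain ⟨d, -, h1, h2⟩ := w.exists_boundary_dart {.inl i, .inr i} (by simp) (by simp [hk])
  have ha := d.adj
  revert h1 h2 ha
  generalize d.fst = x
  generalize d.snd = y
  intro h1 h2 ha
  rcases x with x | x <;> rcases y with y | y <;> simp [bip] at h1 h2 ha <;> subst h1
  · exact ⟨y, h2, .inl ha⟩
  · exact ⟨y, h2, .inr ha⟩

theorem exists_bip (G : SimpleGraph (Fin 6)) (f : Fin 6 → Fin 6) (hf : IsMatchFun G f)
    (hc : G.Colorable 2) : ∃ R, (∀ i, R i i = true) ∧ Nonempty (bip R ≃g G) := by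
  classical
  obtain ⟨c⟩ := hc
  have two : ∀ a b d : Fin 2, a ≠ b → b ≠ d → a = d := by decide
  have hcf : ∀ v, c v ≠ c (f v) := fun v => c.valid (hf v).2
  let E : {v // c v = 0} ≃ {v // ¬ c v = 0} :=
    { toFun := fun v => ⟨f v, fun h => hcf v (v.2.trans h.symm)⟩
      invFun := fun v => ⟨f v, two _ _ _ (hcf v).symm v.2⟩
      left_inv := fun v => Subtype.ext (hf v).1
      right_inv := fun v => Subtype.ext (hf v).1 }
  have hcard : Fintype.card {v // c v = 0} = 3 := by
    have h1 := Fintype.card_congr (Equiv.sumCompl (fun v => c v = 0))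
    rw [Fintype.card_sum, ← Fintype.card_congr E, Fintype.card_fin] at h1
    omega
  let A : Fin 3 ≃ {v // c v = 0} := (Fintype.equivFinOfCardEq hcard).symm
  let e : Fin 3 ⊕ Fin 3 ≃ Fin 6 :=
    (Equiv.sumCongr A (A.trans E)).trans (Equiv.sumCompl (fun v => c v = 0))
  have el : ∀ i, e (.inl i) = (A i : Fin 6) := fun i => rfl
  have er : ∀ i, e (.inr i) = f (A i) := fun i => rfl
  have cl : ∀ i, c (e (.inl i)) = 0 := fun i => (A i).2
  have cr : ∀ i, c (e (.inr i)) ≠ 0 := fun i => (E (A i)).2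
  refine ⟨fun i j => decide (G.Adj (e (.inl i)) (e (.inr j))), ?_, ⟨⟨e, ?_⟩⟩⟩
  · intro i
    simpa [el, er] using (hf (A i)).2
  · rintro (i | i) (j | j)
    · simp only [bip, iff_false]
      exact fun h => c.valid h ((cl i).trans (cl j).symm)
    · exact (decide_eq_true_iff).symm
    · exact (G.adj_comm _ _).trans (decide_eq_true_iff).symm
    · simp only [bip, iff_false]
      exact fun h => c.valid h (two _ 0 _ (cr i) (cr j).symm)

theorem bip_perm_unique {G : SimpleGraph (Fin 6)} (hG : HasUniquePM G)
    {R : Fin 3 → Fin 3 → Bool} (hd : ∀ i, R i i = true) (e : bip R ≃g G)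
    (σ : Equiv.Perm (Fin 3)) (hs : ∀ i, R i (σ i) = true) : σ = 1 := by
  rw [hasUniquePM_iff] at hG
  have mk : ∀ σ : Equiv.Perm (Fin 3), (∀ i, R i (σ i) = true) →
      IsMatchFun G (fun v => e (Sum.elim (fun i => Sum.inr (σ i))
        (fun i => Sum.inl (σ.symm i)) (e.symm v))) := by
    intro σ hs v
    obtain ⟨x, rfl⟩ := e.surjective v
    constructor
    · rcases x with x | x <;> simp
    · simp only [RelIso.symm_apply_apply]
      rw [e.map_adj_iff]
      rcases x with x | x
      · exact hs x
      · have := hs (σ.symm x)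
        rw [Equiv.apply_symm_apply] at this
        exact this
  have h := hG.unique (mk σ hs) (mk 1 hd)
  ext i : 1
  have := congrFun h (e (.inl i))
  simpa using this

/-- up to isomorphism, exactly 3 of the connected simple graphs on
6 vertices with a unique perfect matching are bipartite. -/
theorem stmt10 : ∃ L : List (SimpleGraph (Fin 6)),
    L.length = 3 ∧
    L.Pairwise (fun G H => ¬ Nonempty (G ≃g H)) ∧
    (∀ G ∈ L, G.Connected ∧ HasUniquePM G ∧ G.Colorable 2) ∧
    (∀ G : SimpleGraph (Fin 6), G.Connected → HasUniquePM G → G.Colorable 2 →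
      ∃ H ∈ L, Nonempty (G ≃g H)) := by
  refine ⟨[bip6 true true false, bip6 true false true, bip6 true true true], rfl, ?_, ?_, ?_⟩
  · have d3 : ∀ G H : SimpleGraph (Fin 6), ∀ [DecidableRel G.Adj] [DecidableRel H.Adj],
        (∀ v, G.degree v ≠ 3) → (∃ v, H.degree v = 3) → ¬ Nonempty (G ≃g H) := by
      rintro G H _ _ h1 ⟨v, hv⟩ ⟨e⟩
      apply h1 (e.symm v)
      rw [← hv]
      exact e.symm.degree_eq v
    have dc : ¬ Nonempty (bip6 true false true ≃g bip6 true true true) := by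
      rintro ⟨e⟩
      have := e.card_edgeFinset_eq
      revert this
      decide
    simp only [List.pairwise_cons, List.mem_cons, List.not_mem_nil, or_false]
    refine ⟨?_, ?_, ?_, ?_⟩
    · rintro H (rfl | rfl)
      · exact d3 _ _ (by decide) (by decide)
      · exact d3 _ _ (by decide) (by decide)
    · rintro H rfl
      exact dc
    · simp
    · simp
  · intro G hG
    simp only [List.mem_cons, List.not_mem_nil, or_false] at hG
    rcases hG with rfl | rfl | rfl
    · exact ⟨bip6_conn _ _ _ rfl (by simp), bip6_unique _ _ _, bip6_color _ _ _⟩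
    · exact ⟨bip6_conn _ _ _ rfl (by simp), bip6_unique _ _ _, bip6_color _ _ _⟩
    · exact ⟨bip6_conn _ _ _ rfl (by simp), bip6_unique _ _ _, bip6_color _ _ _⟩
  · intro G hG hu hc
    obtain ⟨f, hf, -⟩ := (hasUniquePM_iff G).1 hu
    obtain ⟨R, hd, ⟨e⟩⟩ := exists_bip G f hf hc
    obtain ⟨τ, p, q, r, ht⟩ := tri_exists R hd (fun σ hs => bip_perm_unique hu hd e σ hs)
    have e1 : bip (tri p q r) ≃g bip R :=
      ⟨Equiv.sumCongr τ τ, by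
        rintro (i | i) (j | j) <;> simp [bip, ht]⟩
    have e2 : G ≃g bip (tri p q r) := (e1.trans e).symm
    have hcon : (bip (tri p q r)).Connected := e2.connected_iff.1 hG
    have c0 := conn_cut hcon 0
    have c1 := conn_cut hcon 1
    have c2 := conn_cut hcon 2
    have hcase : (p, q, r) = (true, true, false) ∨ (p, q, r) = (true, false, true) ∨
        (p, q, r) = (true, true, true) ∨ (p, q, r) = (false, true, true) := by
      clear hcon e2 e1 ht
      revert p q r
      decide
    simp only [Prod.mk.injEq] at hcase
    rcases hcase with ⟨rfl, rfl, rfl⟩ | ⟨rfl, rfl, rfl⟩ | ⟨rfl, rfl, rfl⟩ | ⟨rfl, rfl, rfl⟩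
    · obtain ⟨k⟩ := bip_iso true true false
      exact ⟨_, by simp, ⟨e2.trans k⟩⟩
    · obtain ⟨k⟩ := bip_iso true false true
      exact ⟨bip6 true false true, by simp, ⟨e2.trans k⟩⟩
    · obtain ⟨k⟩ := bip_iso true true true
      exact ⟨bip6 true true true, by simp, ⟨e2.trans k⟩⟩
    · obtain ⟨k⟩ := bip_iso true false true
      obtain ⟨s⟩ := bip_swap
      exact ⟨bip6 true false true, by simp, ⟨(e2.trans s).trans k⟩⟩
end

section
/- Up to graph isomorphism, there is exactly one connected simple graph on 6 vertices with a unique perfect matching whose adjacency matrix A satisfies det A = ±1 (so A⁻¹ is an integer matrix) but which is neither positively invertible nor negatively invertible: no diagonal ±1 matrix D makes all entries of D A⁻¹ D nonnegative, and none makes them all nonpositive. -/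
open Matrix

/-- The integer adjacency matrix of a finite simple graph. -/
noncomputable def adjMat {V : Type*} [Fintype V] [DecidableEq V]
    (G : SimpleGraph V) : Matrix V V ℤ :=
  letI := Classical.decRel G.Adj
  G.adjMatrix ℤ

/-- `A⁻¹` is signable to a nonnegative matrix by a diagonal ±1 matrix. -/
def PosSignable {n : Type*} [Fintype n] [DecidableEq n] (A : Matrix n n ℤ) : Prop :=
  ∃ d : n → ℤ, (∀ i, d i = 1 ∨ d i = -1) ∧
    ∀ i j, 0 ≤ (diagonal d * A⁻¹ * diagonal d) i j

/-- `A⁻¹` is signable to a nonpositive matrix by a diagonal ±1 matrix. -/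
def NegSignable {n : Type*} [Fintype n] [DecidableEq n] (A : Matrix n n ℤ) : Prop :=
  ∃ d : n → ℤ, (∀ i, d i = 1 ∨ d i = -1) ∧
    ∀ i j, (diagonal d * A⁻¹ * diagonal d) i j ≤ 0
/-! ### Finite computation -/

/-- Boolean matrix entry. -/
def bent (L : List (List Bool)) (i j : ℕ) : Bool := (L.getD i []).getD j false

/-- Integer matrix entry. -/
def zent (L : List (List ℤ)) (i j : ℕ) : ℤ := (L.getD i []).getD j 0

/-- Indices `0..5`. -/
def idx6 : List ℕ := [0, 1, 2, 3, 4, 5]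

/-- Fixed-point-free involutions of `Fin 6` other than `(0 1)(2 3)(4 5)`. -/
def others : List (List (Fin 6)) :=
  [[1, 0, 4, 5, 2, 3], [1, 0, 5, 4, 3, 2], [2, 3, 0, 1, 5, 4], [2, 4, 0, 5, 1, 3],
   [2, 5, 0, 4, 3, 1], [3, 2, 1, 0, 5, 4], [3, 4, 5, 0, 1, 2], [3, 5, 4, 0, 2, 1],
   [4, 2, 1, 5, 0, 3], [4, 3, 5, 1, 0, 2], [4, 5, 3, 2, 0, 1], [5, 2, 1, 4, 3, 0],
   [5, 3, 4, 1, 2, 0], [5, 4, 3, 2, 1, 0]]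

/-- renumberings used to recognise the exceptional graph. -/
def renums : List (List (Fin 6)) :=
  [[0, 1, 2, 3, 4, 5], [0, 1, 2, 3, 5, 4], [0, 1, 3, 2, 4, 5], [0, 1, 3, 2, 5, 4],
   [1, 0, 2, 3, 4, 5], [1, 0, 2, 3, 5, 4], [1, 0, 3, 2, 4, 5], [1, 0, 3, 2, 5, 4],
   [2, 3, 0, 1, 4, 5], [2, 3, 0, 1, 5, 4], [2, 3, 1, 0, 4, 5], [2, 3, 1, 0, 5, 4],
   [3, 2, 0, 1, 4, 5], [3, 2, 0, 1, 5, 4], [3, 2, 1, 0, 4, 5], [3, 2, 1, 0, 5, 4],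
   [4, 5, 0, 1, 2, 3], [4, 5, 0, 1, 3, 2], [4, 5, 1, 0, 2, 3], [4, 5, 1, 0, 3, 2],
   [5, 4, 0, 1, 2, 3], [5, 4, 0, 1, 3, 2], [5, 4, 1, 0, 2, 3], [5, 4, 1, 0, 3, 2]]

/-- Graphs containing the matching `01, 23, 45`. -/
def mkL (b0 b1 b2 b3 b4 b5 b6 b7 b8 b9 b10 b11 : Bool) : List (List Bool) :=
  [[false, true, b0, b1, b2, b3], [true, false, b4, b5, b6, b7],
   [b0, b4, false, true, b8, b9], [b1, b5, true, false, b10, b11],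
   [b2, b6, b8, b10, false, true], [b3, b7, b9, b11, true, false]]

/-- The exceptional graph: a fan over a path with four vertices, with a pendant edge at the hub. -/
def L0 : List (List Bool) :=
  mkL true true true true false false false false true false false false

def hasOther (L : List (List Bool)) : Bool :=
  others.any fun f => idx6.all fun i => bent L i (f.getD i 0 : Fin 6).val

def isoL (L : List (List Bool)) : Bool :=
  renums.any fun p => idx6.all fun i => idx6.all fun j =>
    bent L (p.getD i 0 : Fin 6).val (p.getD j 0 : Fin 6).val == bent L0 i j

/-- Sum of the selected rows; a row is an integer vector packed in base `1024`
modulo `1024 ^ 6`. -/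
def rowSum : List Bool → List ℕ → ℕ
  | b :: bs, r :: rs => cond b (r + rowSum bs rs) (rowSum bs rs)
  | _, _ => 0

def mulA (L : List (List Bool)) (R : List ℕ) : List ℕ :=
  L.map fun row => rowSum row R % 1152921504606846976

/-- Digit `j` of a packed row, shifted by `512`. -/
def dig (r j : ℕ) : ℕ :=
  (((r + 577024252550054400) % 1152921504606846976) / 1024 ^ j) % 1024

def addDiag (c : ℕ) : List ℕ → List ℕ
  | [r0, r1, r2, r3, r4, r5] =>
    [r0 + c, r1 + c * 1024, r2 + c * 1048576, r3 + c * 1073741824, r4 + c * 1099511627776,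
     r5 + c * 1125899906842624]
  | _ => []

def traceS : List ℕ → ℕ
  | [r0, r1, r2, r3, r4, r5] =>
    dig r0 0 + dig r1 1 + dig r2 2 + dig r3 3 + dig r4 4 + dig r5 5
  | _ => 0

/-- Faddeev-LeVerrier step. -/
def flCoef (k : ℕ) (AM : List ℕ) : ℕ :=
  (33792 - traceS AM) / k + 1152921504606846976 - 30720 / k

def cof (L : List (List Bool)) : List ℕ :=
  let M1 := addDiag 1 [0, 0, 0, 0, 0, 0]
  let P1 := mulA L M1
  let M2 := addDiag (flCoef 1 P1) P1
  let P2 := mulA L M2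
  let M3 := addDiag (flCoef 2 P2) P2
  let P3 := mulA L M3
  let M4 := addDiag (flCoef 3 P3) P3
  let P4 := mulA L M4
  let M5 := addDiag (flCoef 4 P4) P4
  let P5 := mulA L M5
  addDiag (flCoef 5 P5) P5

def unshift (n : ℕ) : ℤ := Int.subNatNat n 512

def unpack (R : List ℕ) : List (List ℤ) :=
  R.map fun r => [unshift (dig r 0), unshift (dig r 1), unshift (dig r 2), unshift (dig r 3), unshift (dig r 4),
    unshift (dig r 5)]

/-- All sign vectors of a given length. -/
def signs : ℕ → List (List ℤ)
  | 0 => [[]]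
  | n + 1 => (signs n).map (fun l => 1 :: l) ++ (signs n).map (fun l => -1 :: l)

def selZ (b : Bool) (x : ℤ) : ℤ := cond b x 0

def prodEnt (L : List (List Bool)) (B : List (List ℤ)) (i j : ℕ) : ℤ :=
  selZ (bent L i 0) (zent B 0 j) + selZ (bent L i 1) (zent B 1 j) +
  selZ (bent L i 2) (zent B 2 j) + selZ (bent L i 3) (zent B 3 j) +
  selZ (bent L i 4) (zent B 4 j) + selZ (bent L i 5) (zent B 5 j)

def isInv (L : List (List Bool)) (B : List (List ℤ)) (c : ℤ) : Bool :=
  idx6.all fun i => idx6.all fun j => decide (prodEnt L B i j = cond (i == j) c 0)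

def posS (B : List (List ℤ)) : Bool :=
  (signs 6).any fun d => idx6.all fun i => idx6.all fun j =>
    decide (0 ≤ d.getD i 0 * zent B i j * d.getD j 0)

def negS (B : List (List ℤ)) : Bool :=
  (signs 6).any fun d => idx6.all fun i => idx6.all fun j =>
    decide (d.getD i 0 * zent B i j * d.getD j 0 ≤ 0)

def notDvd (B : List (List ℤ)) (c : ℤ) : Bool :=
  idx6.any fun i => idx6.any fun j => !(decide (c ∣ zent B i j))

def goodB (L : List (List Bool)) (B : List (List ℤ)) : Bool :=
  (isInv L B 1 && (posS B || negS B)) || (isInv L B (-3) && notDvd B (-3))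

/-- Degree of a vertex. -/
def degL (L : List (List Bool)) (i : ℕ) : ℕ :=
  cond (bent L i 0) 1 0 + cond (bent L i 1) 1 0 + cond (bent L i 2) 1 0 +
  cond (bent L i 3) 1 0 + cond (bent L i 4) 1 0 + cond (bent L i 5) 1 0

/-- Degree normalisation. -/
def ordered (L : List (List Bool)) : Bool :=
  Nat.ble (degL L 1) (degL L 0) && Nat.ble (degL L 3) (degL L 2) &&
  Nat.ble (degL L 2) (degL L 0) && Nat.ble (degL L 5) (degL L 4) &&
  Nat.ble (degL L 4) (degL L 2)

def chk (L : List (List Bool)) : Bool :=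
  !(ordered L) || hasOther L || goodB L (unpack (cof L)) || isoL L

theorem chk_all : ∀ b0 b1 b2 b3 b4 b5 b6 b7 b8 b9 b10 b11 : Bool,
    chk (mkL b0 b1 b2 b3 b4 b5 b6 b7 b8 b9 b10 b11) = true := by
  decide +kernel

/-! ### Perfect matchings as involutions -/

/-- `f` is a fixed-point-free involution along edges of `G`. -/
def IsPMFun {V : Type*} (G : SimpleGraph V) (f : V → V) : Prop :=
  (∀ v, f (f v) = v) ∧ ∀ v, G.Adj v (f v)

/-- The subgraph attached to a matching function. -/
def pmSub {V : Type*} (G : SimpleGraph V) (f : V → V) (hf : IsPMFun G f) : G.Subgraph where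
  verts := Set.univ
  Adj v w := f v = w
  adj_sub := by
    intro v w h
    rw [← h]
    exact hf.2 v
  edge_vert := fun _ => Set.mem_univ _
  symm := by
    constructor
    intro v w h
    rw [← h]
    exact hf.1 v

theorem pmSub_isPM {V : Type*} (G : SimpleGraph V) (f : V → V) (hf : IsPMFun G f) :
    (pmSub G f hf).IsPerfectMatching := by
  rw [SimpleGraph.Subgraph.isPerfectMatching_iff]
  intro v
  exact ⟨f v, rfl, fun w hw => Eq.symm hw⟩

theorem exists_pmFun {V : Type*} (G : SimpleGraph V) (M : G.Subgraph)
    (hM : M.IsPerfectMatching) : ∃ f, IsPMFun G f ∧ ∀ v w, M.Adj v w ↔ f v = w := by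
  rw [SimpleGraph.Subgraph.isPerfectMatching_iff] at hM
  choose f hf hu using hM
  have key : ∀ v w, M.Adj v w ↔ f v = w := fun v w =>
    ⟨fun h => (hu v w h).symm, fun h => h ▸ hf v⟩
  exact ⟨f, ⟨fun v => (key _ _).1 (hf v).symm, fun v => (hf v).adj_sub⟩, key⟩

theorem hasUniquePM_to {V : Type*} {G : SimpleGraph V} (h : HasUniquePM G) :
    ∃ f, IsPMFun G f ∧ ∀ g, IsPMFun G g → g = f := by
  obtain ⟨M, hM, hu⟩ := h
  obtain ⟨f, hf, hfM⟩ := exists_pmFun G M hM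
  refine ⟨f, hf, fun g hg => ?_⟩
  have := hu _ (pmSub_isPM G g hg)
  funext v
  have h2 : M.Adj v (g v) := by
    rw [← this]
    rfl
  exact ((hfM _ _).1 h2).symm

theorem hasUniquePM_of {V : Type*} {G : SimpleGraph V} (f : V → V) (hf : IsPMFun G f)
    (hu : ∀ g, IsPMFun G g → g = f) : HasUniquePM G := by
  refine ⟨pmSub G f hf, pmSub_isPM G f hf, fun M hM => ?_⟩
  obtain ⟨g, hg, hgM⟩ := exists_pmFun G M hM
  have hgf := hu g hg
  subst hgf
  refine SimpleGraph.Subgraph.ext ?_ ?_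
  · exact Set.eq_univ_of_forall hM.2
  · funext v w
    exact propext (hgM v w)

/-! ### Transport along renumberings -/

/-- The standard involution `(0 1)(2 3)(4 5)`. -/
def inv0 : Equiv.Perm (Fin 6) := Equiv.swap 0 1 * Equiv.swap 2 3 * Equiv.swap 4 5

theorem cycleType_inv (f : Equiv.Perm (Fin 6)) (h1 : ∀ v, f (f v) = v) (h2 : ∀ v, f v ≠ v) :
    f.cycleType = Multiset.replicate 3 2 := by
  have ho : orderOf f = 2 := by
    apply orderOf_eq_prime
    · ext v
      simp [pow_two, h1]
    · intro h
      exact h2 0 (by simp [h])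
  obtain ⟨n, hn⟩ := Equiv.Perm.cycleType_prime_order (σ := f) (by rw [ho]; exact Nat.prime_two)
  rw [ho] at hn
  have hs := Equiv.Perm.sum_cycleType f
  have hsup : f.support = Finset.univ := by
    ext v
    simp [h2]
  rw [hn, hsup] at hs
  simp at hs
  have : n = 2 := by omega
  rw [hn, this]

theorem exists_conj (f : Fin 6 → Fin 6) (h1 : ∀ v, f (f v) = v) (h2 : ∀ v, f v ≠ v) :
    ∃ e : Equiv.Perm (Fin 6), ∀ i, f (e i) = e (inv0 i) := by
  let F : Equiv.Perm (Fin 6) := ⟨f, f, h1, h1⟩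
  have hF := cycleType_inv F h1 h2
  have h0 := cycleType_inv inv0 (by decide) (by decide)
  have hc : IsConj inv0 F := Equiv.Perm.isConj_iff_cycleType_eq.2 (h0.trans hF.symm)
  obtain ⟨c, hc⟩ := isConj_iff.1 hc
  refine ⟨c, fun i => ?_⟩
  have : F (c i) = (c * inv0 * c⁻¹) (c i) := by rw [hc]
  have h3 : c⁻¹ (c i) = i := c.symm_apply_apply i
  simp only [Equiv.Perm.coe_mul, Function.comp_apply, h3] at this
  exact this

theorem exists_conj_max (f : Fin 6 → Fin 6) (h1 : ∀ v, f (f v) = v) (h2 : ∀ v, f v ≠ v)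
    (D : Fin 6 → ℕ) :
    ∃ e : Equiv.Perm (Fin 6), (∀ i, f (e i) = e (inv0 i)) ∧
      D (e 1) ≤ D (e 0) ∧ D (e 3) ≤ D (e 2) ∧ D (e 2) ≤ D (e 0) ∧ D (e 5) ≤ D (e 4) ∧
      D (e 4) ≤ D (e 2) := by
  classical
  let S : Finset (Equiv.Perm (Fin 6)) := Finset.univ.filter fun e => ∀ i, f (e i) = e (inv0 i)
  have hS : S.Nonempty := by
    obtain ⟨e, he⟩ := exists_conj f h1 h2
    exact ⟨e, by simp [S, he]⟩
  obtain ⟨e, he, hmax⟩ := S.exists_max_image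
    (fun e => 3 * D (e 0) + 2 * D (e 2) + D (e 4)) hS
  have he' : ∀ i, f (e i) = e (inv0 i) := by simpa [S] using he
  have step : ∀ t : Equiv.Perm (Fin 6), (∀ i, t (inv0 i) = inv0 (t i)) →
      3 * D (e (t 0)) + 2 * D (e (t 2)) + D (e (t 4)) ≤
        3 * D (e 0) + 2 * D (e 2) + D (e 4) := by
    intro t ht
    refine hmax (e * t) ?_
    simp [S, he', ht]
  have a1 := step (Equiv.swap 0 1) (by decide)
  have a2 := step (Equiv.swap 2 3) (by decide)
  have a3 := step (Equiv.swap 4 5) (by decide)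
  have a4 := step (Equiv.swap 0 2 * Equiv.swap 1 3) (by decide)
  have a5 := step (Equiv.swap 2 4 * Equiv.swap 3 5) (by decide)
  have v1 : ((Equiv.swap 0 1 : Equiv.Perm (Fin 6)) 0 = 1) ∧
    ((Equiv.swap 0 1 : Equiv.Perm (Fin 6)) 2 = 2) ∧
    ((Equiv.swap 0 1 : Equiv.Perm (Fin 6)) 4 = 4) := by decide
  have v2 : ((Equiv.swap 2 3 : Equiv.Perm (Fin 6)) 0 = 0) ∧
    ((Equiv.swap 2 3 : Equiv.Perm (Fin 6)) 2 = 3) ∧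
    ((Equiv.swap 2 3 : Equiv.Perm (Fin 6)) 4 = 4) := by decide
  have v3 : ((Equiv.swap 4 5 : Equiv.Perm (Fin 6)) 0 = 0) ∧
    ((Equiv.swap 4 5 : Equiv.Perm (Fin 6)) 2 = 2) ∧
    ((Equiv.swap 4 5 : Equiv.Perm (Fin 6)) 4 = 5) := by decide
  have v4 : ((Equiv.swap 0 2 * Equiv.swap 1 3 : Equiv.Perm (Fin 6)) 0 = 2) ∧
    ((Equiv.swap 0 2 * Equiv.swap 1 3 : Equiv.Perm (Fin 6)) 2 = 0) ∧
    ((Equiv.swap 0 2 * Equiv.swap 1 3 : Equiv.Perm (Fin 6)) 4 = 4) := by decide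
  have v5 : ((Equiv.swap 2 4 * Equiv.swap 3 5 : Equiv.Perm (Fin 6)) 0 = 0) ∧
    ((Equiv.swap 2 4 * Equiv.swap 3 5 : Equiv.Perm (Fin 6)) 2 = 4) ∧
    ((Equiv.swap 2 4 * Equiv.swap 3 5 : Equiv.Perm (Fin 6)) 4 = 2) := by decide
  rw [v1.1, v1.2.1, v1.2.2] at a1
  rw [v2.1, v2.2.1, v2.2.2] at a2
  rw [v3.1, v3.2.1, v3.2.2] at a3
  rw [v4.1, v4.2.1, v4.2.2] at a4
  rw [v5.1, v5.2.1, v5.2.2] at a5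
  refine ⟨e, he', ?_, ?_, ?_, ?_, ?_⟩ <;> omega

theorem adjMat_apply {V : Type*} [Fintype V] [DecidableEq V] (G : SimpleGraph V) (i j : V)
    [Decidable (G.Adj i j)] : adjMat G i j = if G.Adj i j then 1 else 0 := by
  unfold adjMat
  simp only [SimpleGraph.adjMatrix_apply]
  congr

theorem adjMat_comap {V : Type*} [Fintype V] [DecidableEq V] (G : SimpleGraph V)
    (e : Equiv.Perm V) : adjMat (G.comap e) = (adjMat G).submatrix e e := by
  classical
  ext i j
  simp [adjMat_apply]

theorem pos_of_submatrix {V : Type*} [Fintype V] [DecidableEq V] (A : Matrix V V ℤ)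
    (e : Equiv.Perm V) (h : PosSignable (A.submatrix e e)) : PosSignable A := by
  obtain ⟨d, hd, h⟩ := h
  refine ⟨fun i => d (e.symm i), fun i => hd _, fun i j => ?_⟩
  have := h (e.symm i) (e.symm j)
  simpa [Matrix.inv_submatrix_equiv, Matrix.mul_diagonal, Matrix.diagonal_mul] using this

theorem neg_of_submatrix {V : Type*} [Fintype V] [DecidableEq V] (A : Matrix V V ℤ)
    (e : Equiv.Perm V) (h : NegSignable (A.submatrix e e)) : NegSignable A := by
  obtain ⟨d, hd, h⟩ := h
  refine ⟨fun i => d (e.symm i), fun i => hd _, fun i j => ?_⟩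
  have := h (e.symm i) (e.symm j)
  simpa [Matrix.inv_submatrix_equiv, Matrix.mul_diagonal, Matrix.diagonal_mul] using this

/-! ### Soundness of the computation -/

theorem all6_s11 {p : ℕ → Bool} (h : idx6.all p = true) (i : Fin 6) : p i.val = true := by
  simp only [idx6, List.all_cons, List.all_nil, Bool.and_true, Bool.and_eq_true] at h
  obtain ⟨h0, h1, h2, h3, h4, h5⟩ := h
  fin_cases i <;> assumption

theorem any6 {p : ℕ → Bool} (h : idx6.any p = true) : ∃ i : Fin 6, p i.val = true := by
  simp only [idx6, List.any_cons, List.any_nil, Bool.or_false, Bool.or_eq_true] at h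
  rcases h with h | h | h | h | h | h
  exacts [⟨0, h⟩, ⟨1, h⟩, ⟨2, h⟩, ⟨3, h⟩, ⟨4, h⟩, ⟨5, h⟩]

/-- `L` is the Boolean adjacency matrix of `G`. -/
def IsBoolAdj (G : SimpleGraph (Fin 6)) (L : List (List Bool)) : Prop :=
  ∀ i j : Fin 6, bent L i j = true ↔ G.Adj i j

theorem others_spec : ∀ l ∈ others, (∀ i : Fin 6, l.getD (l.getD i.val 0).val 0 = i) ∧
    ∃ i : Fin 6, l.getD i.val 0 ≠ inv0 i := by
  decide

theorem renums_spec : ∀ l ∈ renums, Function.Injective fun i : Fin 6 => l.getD i.val 0 := by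
  decide +kernel

theorem signs_spec : ∀ l ∈ signs 6, ∀ i : Fin 6, l.getD i.val 0 = 1 ∨ l.getD i.val 0 = -1 := by
  decide +kernel

theorem hasOther_sound {G : SimpleGraph (Fin 6)} {L : List (List Bool)} (hL : IsBoolAdj G L)
    (hu : ∀ g, IsPMFun G g → g = inv0) : hasOther L = false := by
  by_contra h
  rw [Bool.not_eq_false, hasOther, List.any_eq_true] at h
  obtain ⟨l, hl, h⟩ := h
  obtain ⟨h1, i, hi⟩ := others_spec l hl
  have := hu (fun i => l.getD i.val 0) ⟨h1, fun v => (hL _ _).1 (all6_s11 h v)⟩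
  exact hi (congrFun this i)

/-- The exceptional graph. -/
def G0 : SimpleGraph (Fin 6) where
  Adj i j := bent L0 i j = true
  symm := by
    constructor
    decide
  loopless := by
    constructor
    decide

theorem isoL_sound {G : SimpleGraph (Fin 6)} {L : List (List Bool)} (hL : IsBoolAdj G L)
    (h : isoL L = true) : Nonempty (G ≃g G0) := by
  rw [isoL, List.any_eq_true] at h
  obtain ⟨p, hp, h⟩ := h
  have hinj := renums_spec p hp
  let s : Equiv.Perm (Fin 6) := Equiv.ofBijective _ (Finite.injective_iff_bijective.1 hinj)
  refine ⟨SimpleGraph.Iso.symm ⟨s, ?_⟩⟩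
  intro i j
  have h2 := all6_s11 (all6_s11 h i) j
  rw [beq_iff_eq] at h2
  change G.Adj (p.getD i.val 0) (p.getD j.val 0) ↔ bent L0 i j = true
  rw [← hL, h2]

/-- The integer matrix of a list. -/
def matZ (B : List (List ℤ)) : Matrix (Fin 6) (Fin 6) ℤ := fun i j => zent B i j

theorem isInv_sound {G : SimpleGraph (Fin 6)} {L : List (List Bool)} (hL : IsBoolAdj G L)
    {B : List (List ℤ)} {c : ℤ} (h : isInv L B c = true) :
    adjMat G * matZ B = c • (1 : Matrix (Fin 6) (Fin 6) ℤ) := by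
  classical
  ext i j
  have h2 := all6_s11 (all6_s11 h i) j
  rw [decide_eq_true_eq] at h2
  have hs : ∀ k : Fin 6, adjMat G i k * matZ B k j = selZ (bent L i k) (zent B k j) := by
    intro k
    rw [adjMat_apply]
    by_cases hk : G.Adj i k
    · rw [(hL i k).2 hk]
      simp [hk, selZ, matZ]
    · have : bent L i k = false := by
        rw [← Bool.not_eq_true, hL]
        exact hk
      rw [this]
      simp [hk, selZ]
  rw [Matrix.mul_apply, Finset.sum_congr rfl fun k _ => hs k, Fin.sum_univ_six]
  refine Eq.trans h2 ?_
  by_cases hij : i = j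
  · subst hij
    simp
  · have : ((i : ℕ) == (j : ℕ)) = false := by
      simpa [Fin.ext_iff] using hij
    rw [this]
    simp [hij]

theorem posS_sound {A : Matrix (Fin 6) (Fin 6) ℤ} {B : List (List ℤ)} (hA : A⁻¹ = matZ B)
    (h : posS B = true) : PosSignable A := by
  rw [posS, List.any_eq_true] at h
  obtain ⟨d, hd, h⟩ := h
  refine ⟨fun i => d.getD i.val 0, signs_spec d hd, fun i j => ?_⟩
  have h2 := all6_s11 (all6_s11 h i) j
  rw [decide_eq_true_eq] at h2
  rw [hA, Matrix.mul_diagonal, Matrix.diagonal_mul]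
  exact h2

theorem negS_sound {A : Matrix (Fin 6) (Fin 6) ℤ} {B : List (List ℤ)} (hA : A⁻¹ = matZ B)
    (h : negS B = true) : NegSignable A := by
  rw [negS, List.any_eq_true] at h
  obtain ⟨d, hd, h⟩ := h
  refine ⟨fun i => d.getD i.val 0, signs_spec d hd, fun i j => ?_⟩
  have h2 := all6_s11 (all6_s11 h i) j
  rw [decide_eq_true_eq] at h2
  rw [hA, Matrix.mul_diagonal, Matrix.diagonal_mul]
  exact h2

theorem goodB_sound {G : SimpleGraph (Fin 6)} {L : List (List Bool)} (hL : IsBoolAdj G L)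
    (hdet : IsUnit (adjMat G).det) {B : List (List ℤ)} (h : goodB L B = true) :
    PosSignable (adjMat G) ∨ NegSignable (adjMat G) := by
  rw [goodB, Bool.or_eq_true, Bool.and_eq_true, Bool.and_eq_true, Bool.or_eq_true] at h
  rcases h with ⟨h1, h2⟩ | ⟨h1, h2⟩
  · have h3 := isInv_sound hL h1
    rw [one_smul] at h3
    have h4 := Matrix.inv_eq_right_inv h3
    exact h2.imp (posS_sound h4) (negS_sound h4)
  · exfalso
    have h3 := isInv_sound hL h1
    have h4 : matZ B = (-3 : ℤ) • (adjMat G)⁻¹ := by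
      calc matZ B = (adjMat G)⁻¹ * (adjMat G * matZ B) := by
            rw [← Matrix.mul_assoc, Matrix.nonsing_inv_mul _ hdet, Matrix.one_mul]
        _ = _ := by rw [h3, Matrix.mul_smul, Matrix.mul_one]
    obtain ⟨i, h2⟩ := any6 h2
    obtain ⟨j, h2⟩ := any6 h2
    simp only [Bool.not_eq_true', decide_eq_false_iff_not] at h2
    exact h2 ⟨(adjMat G)⁻¹ i j, congrFun (congrFun h4 i) j⟩

theorem exists_rep (G : SimpleGraph (Fin 6)) (h : ∀ i, G.Adj i (inv0 i)) :
    ∃ b0 b1 b2 b3 b4 b5 b6 b7 b8 b9 b10 b11 : Bool,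
      IsBoolAdj G (mkL b0 b1 b2 b3 b4 b5 b6 b7 b8 b9 b10 b11) := by
  classical
  refine ⟨decide (G.Adj 0 2), decide (G.Adj 0 3), decide (G.Adj 0 4), decide (G.Adj 0 5),
    decide (G.Adj 1 2), decide (G.Adj 1 3), decide (G.Adj 1 4), decide (G.Adj 1 5),
    decide (G.Adj 2 4), decide (G.Adj 2 5), decide (G.Adj 3 4), decide (G.Adj 3 5), ?_⟩
  have h01 : G.Adj 0 1 := h 0
  have h23 : G.Adj 2 3 := h 2
  have h45 : G.Adj 4 5 := h 4
  have e (i j : Fin 6) : (decide (G.Adj i j) = true ↔ G.Adj i j) := decide_eq_true_iff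
  have e' (i j : Fin 6) : (decide (G.Adj i j) = true ↔ G.Adj j i) := by
    rw [decide_eq_true_iff, G.adj_comm]
  have t (i j : Fin 6) (hij : G.Adj i j) : (true = true ↔ G.Adj i j) := by simp [hij]
  have f (i : Fin 6) : (false = true ↔ G.Adj i i) := by simp
  intro i j
  fin_cases i <;> fin_cases j <;>
    first
    | exact e _ _
    | exact e' _ _
    | exact f _
    | exact t _ _ h01
    | exact t _ _ h01.symm
    | exact t _ _ h23
    | exact t _ _ h23.symm
    | exact t _ _ h45
    | exact t _ _ h45.symm

/-- Degree of a vertex as an explicit sum. -/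
noncomputable def degG (G : SimpleGraph (Fin 6)) (v : Fin 6) : ℕ :=
  letI := Classical.decRel G.Adj
  ∑ w, if G.Adj v w then 1 else 0

theorem degG_comap (G : SimpleGraph (Fin 6)) (e : Equiv.Perm (Fin 6)) (i : Fin 6) :
    degG (G.comap e) i = degG G (e i) := by
  unfold degG
  refine Eq.trans ?_ (Equiv.sum_comp e _)
  refine Finset.sum_congr rfl fun w _ => ?_
  rfl

theorem degL_eq {G : SimpleGraph (Fin 6)} {L : List (List Bool)} (hL : IsBoolAdj G L) (i : Fin 6) :
    degL L i = degG G i := by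
  have hs : ∀ k : Fin 6, (cond (bent L i k) 1 0 : ℕ) =
      @ite _ (G.Adj i k) (Classical.decRel G.Adj i k) 1 0 := by
    intro k
    by_cases hk : G.Adj i k
    · rw [(hL i k).2 hk, if_pos hk]
      rfl
    · have : bent L i k = false := by
        rw [← Bool.not_eq_true, hL]
        exact hk
      rw [this, if_neg hk]
      rfl
  unfold degG
  simp only [← hs]
  rw [Fin.sum_univ_six]
  rfl

theorem main_normal (G : SimpleGraph (Fin 6)) (h : ∀ i, G.Adj i (inv0 i))
    (hu : ∀ g, IsPMFun G g → g = inv0) (hdet : IsUnit (adjMat G).det)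
    (hdeg : degG G 1 ≤ degG G 0 ∧ degG G 3 ≤ degG G 2 ∧ degG G 2 ≤ degG G 0 ∧
      degG G 5 ≤ degG G 4 ∧ degG G 4 ≤ degG G 2)
    (hp : ¬ PosSignable (adjMat G)) (hn : ¬ NegSignable (adjMat G)) : Nonempty (G ≃g G0) := by
  obtain ⟨b0, b1, b2, b3, b4, b5, b6, b7, b8, b9, b10, b11, hL⟩ := exists_rep G h
  have hc := chk_all b0 b1 b2 b3 b4 b5 b6 b7 b8 b9 b10 b11
  generalize mkL b0 b1 b2 b3 b4 b5 b6 b7 b8 b9 b10 b11 = L at hL hc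
  have ho : ordered L = true := by
    obtain ⟨d1, d2, d3, d4, d5⟩ := hdeg
    simp only [← degL_eq hL] at d1 d2 d3 d4 d5
    simp only [ordered, Bool.and_eq_true, Nat.ble_eq]
    exact ⟨⟨⟨⟨d1, d2⟩, d3⟩, d4⟩, d5⟩
  rw [chk, ho, hasOther_sound hL hu] at hc
  simp only [Bool.not_true, Bool.false_or, Bool.or_eq_true] at hc
  rcases hc with hc | hc
  · rcases goodB_sound hL hdet hc with h | h
    · exact absurd h hp
    · exact absurd h hn
  · exact isoL_sound hL hc

theorem main_general (G : SimpleGraph (Fin 6)) (hU : HasUniquePM G)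
    (hdet : (adjMat G).det = 1 ∨ (adjMat G).det = -1)
    (hp : ¬ PosSignable (adjMat G)) (hn : ¬ NegSignable (adjMat G)) : Nonempty (G ≃g G0) := by
  obtain ⟨f, hf, hu⟩ := hasUniquePM_to hU
  obtain ⟨e, he, hdeg⟩ := exists_conj_max f hf.1 (fun v => (hf.2 v).ne') (degG G)
  have hA := adjMat_comap G e
  obtain ⟨φ⟩ : Nonempty (G.comap e ≃g G0) := by
    apply main_normal
    · intro i
      rw [SimpleGraph.comap_adj, ← he]
      exact hf.2 _
    · intro g hg
      have := hu (fun v => e (g (e.symm v))) ⟨fun v => by simp [hg.1], fun v => by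
        have h3 := hg.2 (e.symm v)
        rw [SimpleGraph.comap_adj] at h3
        simpa using h3⟩
      funext i
      have h4 := congrFun this (e i)
      simp only [Equiv.symm_apply_apply, he] at h4
      exact e.injective h4
    · rw [hA, Matrix.det_submatrix_equiv_self]
      exact Int.isUnit_iff.2 hdet
    · simpa only [degG_comap] using hdeg
    · rw [hA]
      exact fun h => hp (pos_of_submatrix _ e h)
    · rw [hA]
      exact fun h => hn (neg_of_submatrix _ e h)
  exact ⟨(SimpleGraph.Iso.comap e G).symm.trans φ⟩

/-! ### The exceptional graph -/

/-- The inverse of the adjacency matrix of the exceptional graph. -/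
def B0 : List (List ℤ) :=
  [[0, 1, 0, 0, 0, 0], [1, 2, -1, 0, -1, 0], [0, -1, 0, 1, 0, 0], [0, 0, 1, 0, 0, -1],
   [0, -1, 0, 0, 0, 1], [0, 0, 0, -1, 1, 0]]

theorem rep_G0 : IsBoolAdj G0 L0 := fun _ _ => Iff.rfl

theorem mul_B0 : adjMat G0 * matZ B0 = 1 := by
  have := isInv_sound rep_G0 (B := B0) (c := 1) (by decide)
  rwa [one_smul] at this

theorem G0_connected : G0.Connected := by
  have h0 : ∀ v, v ≠ 0 → bent L0 ((0 : Fin 6) : ℕ) (v : Fin 6) = true := by decide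
  have hr : ∀ v, G0.Reachable 0 v := by
    intro v
    by_cases hv : v = 0
    · rw [hv]
    · exact SimpleGraph.Adj.reachable (h0 v hv)
  have : Nonempty (Fin 6) := ⟨0⟩
  exact ⟨fun u v => (hr u).symm.trans (hr v)⟩

theorem G0_uniquePM : HasUniquePM G0 := by
  refine hasUniquePM_of inv0 ⟨by decide, ?_⟩ ?_
  · change ∀ v : Fin 6, bent L0 v (inv0 v) = true
    decide
  · intro g hg
    have h1 : ∀ x : Fin 6, bent L0 ((1 : Fin 6) : ℕ) x = true → x = 0 := by decide
    have h3 : ∀ x : Fin 6, bent L0 ((3 : Fin 6) : ℕ) x = true → x = 0 ∨ x = 2 := by decide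
    have h5 : ∀ x : Fin 6, bent L0 ((5 : Fin 6) : ℕ) x = true → x = 0 ∨ x = 4 := by decide
    have g1 : g 1 = 0 := h1 _ (hg.2 1)
    have g0 : g 0 = 1 := by rw [← g1, hg.1]
    have g3 : g 3 = 2 := by
      rcases h3 _ (hg.2 3) with h | h
      · have := hg.1 3
        rw [h, g0] at this
        exact absurd this (by decide)
      · exact h
    have g2 : g 2 = 3 := by rw [← g3, hg.1]
    have g5 : g 5 = 4 := by
      rcases h5 _ (hg.2 5) with h | h
      · have := hg.1 5
        rw [h, g0] at this
        exact absurd this (by decide)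
      · exact h
    have g4 : g 4 = 5 := by rw [← g5, hg.1]
    funext i
    fin_cases i
    exacts [g0, g1, g2, g3, g4, g5]

theorem G0_det : (adjMat G0).det = 1 ∨ (adjMat G0).det = -1 := by
  have h := congrArg Matrix.det mul_B0
  rw [Matrix.det_mul, Matrix.det_one] at h
  exact Int.isUnit_iff.1 (IsUnit.of_mul_eq_one _ h)

theorem G0_entry (d : Fin 6 → ℤ) (i j : Fin 6) :
    (diagonal d * (adjMat G0)⁻¹ * diagonal d) i j = d i * zent B0 i j * d j := by
  rw [Matrix.inv_eq_right_inv mul_B0, Matrix.mul_diagonal, Matrix.diagonal_mul]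
  rfl

theorem G0_not_pos : ¬ PosSignable (adjMat G0) := by
  rintro ⟨d, hd, h⟩
  simp only [G0_entry] at h
  have a := h 1 2
  have b := h 2 3
  have c := h 3 5
  have e := h 5 4
  have f := h 4 1
  norm_num [zent, B0] at a b c e f
  rcases hd 1 with h1 | h1 <;> rcases hd 2 with h2 | h2 <;> rcases hd 3 with h3 | h3 <;>
    rcases hd 4 with h4 | h4 <;> rcases hd 5 with h5 | h5 <;>
    rw [h1, h2] at a <;> rw [h2, h3] at b <;> rw [h3, h5] at c <;> rw [h5, h4] at e <;>
    rw [h4, h1] at f <;> omega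

theorem G0_not_neg : ¬ NegSignable (adjMat G0) := by
  rintro ⟨d, hd, h⟩
  simp only [G0_entry] at h
  have a := h 1 1
  norm_num [zent, B0] at a
  rcases hd 1 with h1 | h1 <;> rw [h1] at a <;> omega

/-- up to isomorphism, there is exactly one connected simple graph
on 6 vertices with a unique perfect matching whose adjacency matrix has
determinant ±1 but which is neither positively nor negatively invertible. -/
theorem stmt11 : ∃ G₀ : SimpleGraph (Fin 6),
    G₀.Connected ∧ HasUniquePM G₀ ∧
    ((adjMat G₀).det = 1 ∨ (adjMat G₀).det = -1) ∧
    ¬ PosSignable (adjMat G₀) ∧ ¬ NegSignable (adjMat G₀) ∧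
    ∀ G : SimpleGraph (Fin 6), G.Connected → HasUniquePM G →
      ((adjMat G).det = 1 ∨ (adjMat G).det = -1) →
      ¬ PosSignable (adjMat G) → ¬ NegSignable (adjMat G) →
      Nonempty (G ≃g G₀) := by
  exact ⟨G0, G0_connected, G0_uniquePM, G0_det, G0_not_pos, G0_not_neg,
    fun G _ hU hdet hp hn => main_general G hU hdet hp hn⟩
end

section
/- Every connected simple graph G with a unique perfect matching M contains a bridge belonging to M; that is, there is an edge e ∈ M whose removal disconnects G (Kotzig's theorem). -/
/-- Arcs: leave `x` by a non-matching edge to `m y`, then traverse the matching edge to `y`. -/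
def KArc {V : Type*} (G : SimpleGraph V) (m : V → V) (x y : V) : Prop :=
  G.Adj x (m y) ∧ x ≠ y

/-- Regular lists: alternating paths. -/
def KReg {V : Type*} (G : SimpleGraph V) (m : V → V) (l : List V) : Prop :=
  l.IsChain (KArc G m) ∧ l.Pairwise (fun a b => a ≠ b ∧ a ≠ m b)

/-- Reachability by regular lists. -/
def KReach {V : Type*} (G : SimpleGraph V) (m : V → V) (y z : V) : Prop :=
  ∃ l, KReg G m l ∧ l.head? = some y ∧ l.getLast? = some z

section Kotzig

variable {V : Type*} {G : SimpleGraph V} {m : V → V}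

theorem KReg.rev (hm : ∀ v, m (m v) = v) {l : List V} (h : KReg G m l) :
    KReg G m (l.reverse.map m) := by
  obtain ⟨h1, h2⟩ := h
  constructor
  · rw [List.isChain_map, List.isChain_reverse]
    refine h1.imp ?_
    intro a b hab
    refine ⟨?_, ?_⟩
    · rw [hm]; exact hab.1.symm
    · intro h; apply hab.2; rw [← hm a, ← hm b, h]
  · rw [List.pairwise_map, List.pairwise_reverse]
    refine h2.imp ?_
    intro a b hab
    refine ⟨?_, ?_⟩
    · intro h; apply hab.1; rw [← hm a, ← hm b, h]
    · rw [hm]; intro h; exact hab.2 h.symm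

theorem KReg.left {l1 l2 : List V} (h : KReg G m (l1 ++ l2)) : KReg G m l1 :=
  ⟨h.1.left_of_append, (List.pairwise_append.1 h.2).1⟩

theorem KReg.right {l1 l2 : List V} (h : KReg G m (l1 ++ l2)) : KReg G m l2 :=
  ⟨h.1.right_of_append, (List.pairwise_append.1 h.2).2.1⟩

theorem KReg.app {l1 l2 : List V} (h1 : KReg G m l1) (h2 : KReg G m l2)
    (hc : ∀ x ∈ l1.getLast?, ∀ y ∈ l2.head?, KArc G m x y)
    (hd : ∀ x ∈ l1, ∀ y ∈ l2, x ≠ y ∧ x ≠ m y) : KReg G m (l1 ++ l2) :=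
  ⟨List.isChain_append.2 ⟨h1.1, h2.1, hc⟩, List.pairwise_append.2 ⟨h1.2, h2.2, hd⟩⟩

/-- the key exchange lemma -/
theorem K_key (hm : ∀ v, m (m v) = v)
    (nc : ∀ l x z, KReg G m l → l.head? = some x → l.getLast? = some z → ¬ KArc G m z x)
    {y z : V} {p t : List V} (hp : KReg G m p) (hy : p.head? = some y)
    (hz : p.getLast? = some z) (hq : KReg G m (z :: t))
    (hmeet : ∃ b ∈ t, b ∈ p ∨ m b ∈ p) : KReach G m y (m z) := by
  classical
  obtain ⟨t1, b, t2, rfl, hb, ht1⟩ : ∃ t1 b t2, t = t1 ++ b :: t2 ∧ (b ∈ p ∨ m b ∈ p) ∧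
      ∀ c ∈ t1, ¬ (c ∈ p ∨ m c ∈ p) := by
    clear hq
    induction t with
    | nil => simp at hmeet
    | cons a t ih =>
      by_cases ha : a ∈ p ∨ m a ∈ p
      · exact ⟨[], a, t, by simp, ha, by simp⟩
      · obtain ⟨t1, b, t2, h1, h2, h3⟩ := ih (by
          obtain ⟨b, hb, hb'⟩ := hmeet
          rcases List.mem_cons.1 hb with rfl | hb
          · exact absurd hb' ha
          · exact ⟨b, hb, hb'⟩)
        refine ⟨a :: t1, b, t2, by simp [h1], h2, ?_⟩
        intro c hc
        rcases List.mem_cons.1 hc with rfl | hc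
        · exact ha
        · exact h3 c hc
  have hzb : z ≠ b ∧ z ≠ m b := by
    have := List.pairwise_cons.1 hq.2
    exact this.1 b (by simp)
  have hq1 : KReg G m (z :: t1 ++ [b]) := by
    apply KReg.left (l2 := t2)
    simpa using hq
  have hzt : KReg G m (z :: t1) := hq1.left
  have ht1r : KReg G m t1 := KReg.right (l1 := [z]) hzt
  have hlastb : ∀ x ∈ (z :: t1).getLast?, KArc G m x b := by
    intro x hx
    exact (List.isChain_append.1 hq1.1).2.2 x hx b (by simp)
  by_cases hbp : b ∈ p
  · exfalso
    obtain ⟨p1, p2, rfl⟩ := List.append_of_mem hbp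
    have hr : KReg G m (b :: p2) := hp.right
    have hl : (b :: p2).getLast? = some z := by simpa using hz
    refine nc (b :: p2 ++ t1) b (((z :: t1).getLast?).getD z) ?_ (by simp) ?_ ?_
    · refine hr.app ht1r ?_ ?_
      · intro x hx c hc
        rw [hl] at hx
        obtain rfl : z = x := by simpa using hx
        cases t1 with
        | nil => simp at hc
        | cons d t1 =>
          obtain rfl : d = c := by simpa using hc
          exact (List.isChain_cons_cons.1 hzt.1).1
      · intro x hx c hc
        have := ht1 c hc
        constructor
        · rintro rfl
          exact this (Or.inl (List.mem_append_right _ hx))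
        · rintro rfl
          exact this (Or.inr (List.mem_append_right _ hx))
    · rw [List.getLast?_append, hl]
      cases t1 using List.reverseRecOn <;> simp [List.getLast?_cons]
    · apply hlastb
      cases h : (z :: t1).getLast? with
      | none => simp at h
      | some w => simp
  · have hmb : m b ∈ p := by tauto
    obtain ⟨p1, p2, rfl⟩ := List.append_of_mem hmb
    have hp1 := hp.left
    refine ⟨p1 ++ (z :: t1 ++ [b]).reverse.map m, hp1.app (hq1.rev hm) ?_ ?_, ?_, ?_⟩
    · intro x hx c hc
      obtain rfl : m b = c := by simpa using hc
      exact (List.isChain_append.1 hp.1).2.2 x hx (m b) (by simp)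
    · have hcross := (List.pairwise_append.1 hp.2).2.2
      have hzmem : z ∈ m b :: p2 := by
        have : (m b :: p2).getLast? = some z := by simpa using hz
        exact List.mem_of_getLast? this
      intro x hx c hc
      have hc' : c = m b ∨ (∃ d ∈ t1, c = m d) ∨ c = m z := by
        simp at hc
        rcases hc with h | ⟨d, h1, h2⟩ | h
        · exact Or.inl h
        · exact Or.inr (Or.inl ⟨d, h1, h2.symm⟩)
        · exact Or.inr (Or.inr h)
      rcases hc' with rfl | ⟨d, hd, rfl⟩ | rfl
      · exact hcross x hx (m b) (by simp)
      · have := ht1 d hd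
        rw [hm]
        constructor
        · rintro rfl
          exact this (Or.inr (List.mem_append_left _ hx))
        · rintro rfl
          exact this (Or.inl (List.mem_append_left _ hx))
      · rw [hm]
        exact (hcross x hx z hzmem).symm
    · cases p1 with
      | nil => simpa using hy
      | cons a p1 => simpa using hy
    · simp [List.getLast?_cons]

theorem K_mem_reach {y : V} {p : List V} (hp : KReg G m p) (hy : p.head? = some y) {a : V}
    (ha : a ∈ p) : KReach G m y a := by
  obtain ⟨p1, p2, rfl⟩ := List.append_of_mem ha
  refine ⟨p1 ++ [a], KReg.left (l2 := p2) (by simpa using hp), ?_, by simp⟩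
  cases p1 <;> simpa using hy

theorem K_step [Fintype V] (hm : ∀ v, m (m v) = v)
    (nc : ∀ l x z, KReg G m l → l.head? = some x → l.getLast? = some z → ¬ KArc G m z x)
    {y : V} (hmin : ∀ z, {w | KReach G m y w}.ncard ≤ {w | KReach G m z w}.ncard)
    {z : V} (hyz : KReach G m y z) (hne : z ≠ y) : KReach G m y (m z) := by
  by_contra hno
  obtain ⟨p, hp, hy, hz⟩ := hyz
  have hdis : ∀ t, KReg G m (z :: t) → ∀ b ∈ t, ¬ (b ∈ p ∨ m b ∈ p) := by
    intro t ht b hb hbp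
    exact hno (K_key hm nc hp hy hz ht ⟨b, hb, hbp⟩)
  have hyp : y ∈ p := List.mem_of_mem_head? hy
  have hss : {w | KReach G m z w} ⊂ {w | KReach G m y w} := by
    refine ⟨?_, ?_⟩
    · rintro w ⟨q, hq, hqz, hqw⟩
      cases q with
      | nil => simp at hqz
      | cons a t =>
        obtain rfl : a = z := by simpa using hqz
        refine ⟨p ++ t, hp.app (KReg.right (l1 := [a]) hq) ?_ ?_, ?_, ?_⟩
        · intro x hx c hc
          rw [hz] at hx
          obtain rfl : a = x := by simpa using hx
          cases t with
          | nil => simp at hc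
          | cons d t1 =>
            obtain rfl : d = c := by simpa using hc
            exact (List.isChain_cons_cons.1 hq.1).1
        · intro x hx c hc
          have := hdis t hq c hc
          constructor
          · rintro rfl; exact this (Or.inl hx)
          · rintro rfl; exact this (Or.inr hx)
        · cases p <;> simp_all
        · rw [List.getLast?_append, hz]
          rw [← hqw]
          cases t using List.reverseRecOn <;> simp [List.getLast?_cons]
    · intro h
      obtain ⟨q, hq, hqz, hqw⟩ := h (show KReach G m y y from K_mem_reach hp hy hyp)
      cases q with
      | nil => simp at hqz
      | cons a t =>
        obtain rfl : a = z := by simpa using hqz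
        have hmem := List.mem_of_getLast? hqw
        rcases List.mem_cons.1 hmem with h | h
        · exact hne h.symm
        · exact hdis t hq y h (Or.inl hyp)
  have := Set.ncard_lt_ncard hss (Set.toFinite _)
  have := hmin z
  omega

theorem K_main [Fintype V] [Nonempty V] (hm : ∀ v, m (m v) = v) (hne : ∀ v, m v ≠ v)
    (nc : ∀ l x z, KReg G m l → l.head? = some x → l.getLast? = some z → ¬ KArc G m z x) :
    ∃ y, ¬ (G.deleteEdges {s(y, m y)}).Connected := by
  obtain ⟨y, hmin⟩ := Finite.exists_min (fun y => {w | KReach G m y w}.ncard)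
  refine ⟨y, fun hcon => ?_⟩
  have hstep : ∀ z, KReach G m y z → z ≠ y → KReach G m y (m z) :=
    fun z h h' => K_step hm nc hmin h h'
  have hcl : ∀ z a, KReach G m y z → (G.deleteEdges {s(y, m y)}).Adj z a → KReach G m y a := by
    intro z a hz hza
    rw [SimpleGraph.deleteEdges_adj] at hza
    obtain ⟨hadj, hna⟩ := hza
    by_cases ha : a = m z
    · subst ha
      apply hstep z hz
      rintro rfl
      exact hna rfl
    obtain ⟨p, hp, hy, hpz⟩ := hz
    have harc : KArc G m z (m a) := ⟨by rwa [hm], fun h => ha (by rw [h, hm])⟩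
    by_cases h1 : a ∈ p
    · exact K_mem_reach hp hy h1
    have hfin : KReach G m y (m a) → m a ≠ y → KReach G m y a := by
      intro h h'
      simpa [hm] using hstep _ h h'
    by_cases h2 : m a ∈ p
    · refine hfin (K_mem_reach hp hy h2) ?_
      intro h
      exact nc p y z hp hy hpz (h ▸ harc)
    · refine hfin ⟨p ++ [m a], hp.app ⟨by simp, by simp⟩ ?_ ?_, ?_, by simp⟩ ?_
      · intro x hx c hc
        rw [hpz] at hx
        obtain rfl : z = x := by simpa using hx
        obtain rfl : m a = c := by simpa using hc
        exact harc
      · intro x hx c hc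
        obtain rfl : c = m a := by simpa using hc
        rw [hm]
        constructor
        · rintro rfl; exact h2 hx
        · rintro rfl; exact h1 hx
      · cases p <;> simp_all
      · rintro h
        exact h2 (h ▸ List.mem_of_mem_head? hy)
  have hyy : KReach G m y y := ⟨[y], ⟨by simp, by simp⟩, by simp, by simp⟩
  have hall : ∀ a b, (G.deleteEdges {s(y, m y)}).Walk a b → KReach G m y a → KReach G m y b := by
    intro a b w
    induction w with
    | nil => exact id
    | cons h _ ih => exact fun h' => ih (hcl _ _ h' h)
  obtain ⟨w⟩ := hcon.preconnected y (m y)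
  obtain ⟨l, hl, hly, hlm⟩ := hall _ _ w hyy
  cases l with
  | nil => simp at hly
  | cons a t =>
    obtain rfl : a = y := by simpa using hly
    rcases List.mem_cons.1 (List.mem_of_getLast? hlm) with h | h
    · exact hne a h
    · have := ((List.pairwise_cons.1 hl.2).1 _ h).2
      rw [hm] at this
      exact this rfl

/-- an alternating cycle produces a second matching function -/
theorem K_cycle (hm : ∀ v, m (m v) = v) (hne : ∀ v, m v ≠ v) (hG : ∀ v, G.Adj v (m v))
    {l : List V} {x z : V} (hl : KReg G m l) (hx : l.head? = some x) (hz : l.getLast? = some z)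
    (hzx : KArc G m z x) :
    ∃ m' : V → V, (∀ v, m' (m' v) = v) ∧ (∀ v, G.Adj v (m' v)) ∧ m' x ≠ m x := by
  classical
  have hnd : l.Nodup := hl.2.imp (fun h => h.1)
  have hσ : ∀ v ∈ l, KArc G m v (l.formPerm v) := by
    intro v hv
    obtain ⟨i, hi, rfl⟩ := List.getElem_of_mem hv
    rw [List.formPerm_apply_getElem _ hnd]
    by_cases h : i + 1 < l.length
    · have := List.isChain_iff_getElem.1 hl.1 i h
      simpa [Nat.mod_eq_of_lt h] using this
    · have h' : i + 1 = l.length := by omega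
      have e1 : l[(i+1) % l.length]'(Nat.mod_lt _ (by omega)) = x := by
        have : (i+1) % l.length = 0 := by rw [h']; simp
        simp only [this]
        rw [List.head?_eq_getElem?] at hx
        exact (List.getElem?_eq_some_iff.1 hx).2
      have e2 : l[i] = z := by
        rw [List.getLast?_eq_getElem?] at hz
        have := (List.getElem?_eq_some_iff.1 hz).2
        have hi' : i = l.length - 1 := by omega
        simp only [hi']; exact this
      rw [e1, e2]; exact hzx
  have hmem : ∀ v ∈ l, m v ∉ l := by
    intro v hv hmv
    have : Std.Symm (fun a b : V => a ≠ m b) := ⟨fun a b h h' => h (by rw [h', hm])⟩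
    have := List.Pairwise.forall_of_forall (l := l) (R := fun a b => a ≠ m b)
      (fun a _ => (hne a).symm) (hl.2.imp (fun h => h.2)) hmv hv
    exact this rfl
  set σ := l.formPerm with hs
  have hfix : ∀ v, v ∉ l → σ v = v := fun v hv => List.formPerm_apply_of_notMem hv
  have hfix' : ∀ v, v ∉ l → σ⁻¹ v = v := fun v hv => by
    rw [Equiv.Perm.inv_eq_iff_eq]; exact (hfix v hv).symm
  have hin : ∀ v, v ∈ l → σ v ∈ l := fun v hv => by
    by_contra h
    have := hfix _ h
    rw [σ.injective this] at h
    exact h hv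
  have hv1 : ∀ v ∈ l, σ⁻¹ (m (σ v)) = m (σ v) := fun v hv => hfix' _ (hmem _ (hin v hv))
  refine ⟨fun v => σ⁻¹ (m (σ v)), ?_, ?_, ?_⟩
  · intro v; simp [hm]
  · intro v
    by_cases hv : v ∈ l
    · simp only [hv1 v hv]; exact (hσ v hv).1
    · simp only [hfix v hv]
      by_cases hmv : m v ∈ l
      · have hw : σ⁻¹ (m v) ∈ l := by
          by_contra h
          have := hfix _ h
          rw [← this] at h
          simp at h
          exact h hmv
        have := (hσ _ hw).1
        simp [hm] at this
        exact this.symm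
      · rw [hfix' _ hmv]; exact hG v
  · have hxl : x ∈ l := List.mem_of_mem_head? hx
    simp only [hv1 x hxl]
    intro h
    apply (hσ x hxl).2
    have h' := congrArg m h
    rw [hm, hm] at h'
    exact h'.symm

end Kotzig

/-- Kotzig's theorem: every connected simple graph with a unique
perfect matching `M` contains an edge of `M` whose removal disconnects the
graph (a bridge belonging to `M`). -/
theorem stmt16 {V : Type*} [Fintype V] (G : SimpleGraph V) (hc : G.Connected)
    (M : G.Subgraph) (hM : M.IsPerfectMatching)
    (huniq : ∀ M' : G.Subgraph, M'.IsPerfectMatching → M' = M) :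
    ∃ e ∈ M.edgeSet, ¬ (G.deleteEdges {e}).Connected := by
  have hM' := SimpleGraph.Subgraph.isPerfectMatching_iff.1 hM
  choose m hmA hmU using hM'
  have hm : ∀ v, m (m v) = v := fun v => (hmU (m v) v (hmA v).symm).symm
  have hG : ∀ v, G.Adj v (m v) := fun v => M.adj_sub (hmA v)
  have hne : ∀ v, m v ≠ v := fun v => (hG v).ne'
  have := hc.nonempty
  obtain ⟨y, hy⟩ := K_main (G := G) hm hne (by
    intro l x z hl hx hz hzx
    obtain ⟨m', h1, h2, h3⟩ := K_cycle hm hne hG hl hx hz hzx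
    let M' : G.Subgraph :=
      { verts := Set.univ
        Adj := fun a b => m' a = b
        adj_sub := by rintro a b rfl; exact h2 a
        edge_vert := fun _ => Set.mem_univ _
        symm := ⟨by rintro a b rfl; exact h1 a⟩ }
    have hM'p : M'.IsPerfectMatching := by
      rw [SimpleGraph.Subgraph.isPerfectMatching_iff]
      intro v
      exact ⟨m' v, rfl, fun w hw => Eq.symm hw⟩
    have he := huniq M' hM'p
    have : M'.Adj x (m' x) := rfl
    rw [he] at this
    exact h3 (hmU x _ this))
  exact ⟨s(y, m y), hmA y, hy⟩
end

section
/- If G is a bipartite simple graph having a unique perfect matching, then the determinant of its adjacency matrix over ℤ equals 1 or −1; consequently the adjacency matrix of G is integrally invertible (its inverse is an integer matrix). -/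
/-- The subgraph of edges `{v, f v}` of a fixed-point free involution `f` along edges. -/
def invSubgraph {V : Type*} (G : SimpleGraph V) (f : V → V) (hf : ∀ v, f (f v) = v)
    (hadj : ∀ v, G.Adj v (f v)) : G.Subgraph where
  verts := Set.univ
  Adj a b := f a = b
  adj_sub := by
    intro a b h
    subst h
    exact hadj a
  edge_vert := by
    intro a b h
    trivial
  symm := ⟨by
    intro a b h
    subst h
    exact hf a⟩

theorem pm_inv_unique {V : Type*} (G : SimpleGraph V) (hm : HasUniquePM G) (f g : V → V)
    (hf : ∀ v, f (f v) = v) (hfa : ∀ v, G.Adj v (f v))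
    (hg : ∀ v, g (g v) = v) (hga : ∀ v, G.Adj v (g v)) : f = g := by
  have key : ∀ (f : V → V) (hf : ∀ v, f (f v) = v) (hfa : ∀ v, G.Adj v (f v)),
      (invSubgraph G f hf hfa).IsPerfectMatching := by
    intro f hf hfa
    rw [SimpleGraph.Subgraph.isPerfectMatching_iff]
    intro v
    exact ⟨f v, rfl, fun y hy => Eq.symm hy⟩
  have h := hm.unique (key f hf hfa) (key g hg hga)
  funext v
  have h2 : (invSubgraph G f hf hfa).Adj v (f v) := rfl
  rw [h] at h2
  exact Eq.symm h2

theorem perm_eq {V : Type*} (G : SimpleGraph V) (hm : HasUniquePM G)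
    (c : G.Coloring (Fin 2)) (σ : Equiv.Perm V) (hσ : ∀ v, G.Adj (σ v) v)
    (t : V → V) (ht : ∀ v, t (t v) = v) (hta : ∀ v, G.Adj v (t v)) (v : V) : σ v = t v := by
  classical
  have h1 : ∀ v, c (σ v) ≠ c v := fun v => c.valid (hσ v)
  have h2 : ∀ v, c (σ.symm v) ≠ c v := fun v => by
    have := h1 (σ.symm v)
    rw [Equiv.apply_symm_apply] at this
    exact this.symm
  have h3 : ∀ v, G.Adj v (σ.symm v) := fun v => by
    simpa using hσ (σ.symm v)
  have key := pm_inv_unique G hm (fun w => if c w = c v then σ w else σ.symm w) t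
    (by
      intro w
      have a := h1 w
      have b := h2 w
      by_cases hw : c w = c v
      · have : c (σ w) ≠ c v := by rw [← hw]; exact a
        simp [hw, this]
      · have : c (σ.symm w) = c v := by omega
        simp [hw, this])
    (by
      intro w
      by_cases hw : c w = c v
      · simpa [hw] using (hσ w).symm
      · simpa [hw] using h3 w) ht hta
  have := congrFun key v
  simpa using this

/-- a bipartite simple graph with a unique perfect matching has
adjacency determinant ±1; hence its adjacency matrix is integrally invertible. -/
theorem stmt17 {V : Type*} [Fintype V] [DecidableEq V] (G : SimpleGraph V)
    [DecidableRel G.Adj] (hbip : G.Colorable 2) (hm : HasUniquePM G) :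
    ((G.adjMatrix ℤ).det = 1 ∨ (G.adjMatrix ℤ).det = -1) ∧
    IsUnit (G.adjMatrix ℤ) := by
  have hdet : (G.adjMatrix ℤ).det = 1 ∨ (G.adjMatrix ℤ).det = -1 := by
    obtain ⟨c⟩ := hbip
    obtain ⟨M, hM, -⟩ := id hm
    rw [SimpleGraph.Subgraph.isPerfectMatching_iff] at hM
    choose t hMt huniq using hM
    have ht : ∀ v, t (t v) = v := fun v => (huniq (t v) v (hMt v).symm).symm
    have hta : ∀ v, G.Adj v (t v) := fun v => (hMt v).adj_sub
    let τ : Equiv.Perm V := ⟨t, t, ht, ht⟩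
    have hτ : ∀ v, τ v = t v := fun v => rfl
    have hsum : (G.adjMatrix ℤ).det = (Equiv.Perm.sign τ : ℤ) := by
      rw [Matrix.det_apply', Finset.sum_eq_single τ]
      · have : ∏ i, G.adjMatrix ℤ (τ i) i = 1 := by
          apply Finset.prod_eq_one
          intro v _
          rw [SimpleGraph.adjMatrix_apply, if_pos]
          exact (hta v).symm
        rw [this, mul_one]
        rfl
      · intro σ _ hne
        have : ∃ v, ¬ G.Adj (σ v) v := by
          by_contra! hcon
          exact hne (Equiv.ext fun v => perm_eq G hm c σ hcon t ht hta v)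
        obtain ⟨v, hv⟩ := this
        rw [Finset.prod_eq_zero (Finset.mem_univ v), mul_zero]
        rw [SimpleGraph.adjMatrix_apply, if_neg hv]
      · intro h
        exact absurd (Finset.mem_univ _) h
    rw [hsum]
    rcases Int.units_eq_one_or (Equiv.Perm.sign τ) with h | h <;> simp [h]
  refine ⟨hdet, ?_⟩
  rw [Matrix.isUnit_iff_isUnit_det, Int.isUnit_iff]
  exact hdet
end
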